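/- Let G be a countable abelian group, u ∈ G, and k a field. Then there exist a k-algebra R which is von Neumann regular and purely infinite simple, and a family (P_g)_{g ∈ G} of nonzero finitely generated projective right R-modules, such that: P_{g+h} ≅ P_g ⊕ P_h for all g, h ∈ G; P_u ≅ R as right R-modules; and every nonzero finitely generated projective right R-module is isomorphic to P_g for exactly one g ∈ G. (This says precisely that K₀(R) ≅ G with [R] corresponding to u.) -/

import Mathlib

universe u v w

/-- Murray–von Neumann equivalence of idempotents: `e ∼ f` iff there are `x ∈ eRf`,
`y ∈ fRe` with `x*y = e` and `y*x = f`. -/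
def IdemEquiv {R : Type*} [Ring R] (e f : R) : Prop :=
  ∃ x y : R, x = e * x * f ∧ y = f * y * e ∧ x * y = e ∧ y * x = f

/-- An idempotent `e` is infinite if `e = f + g` for orthogonal idempotents `f, g`
with `g ≠ 0` and `e ∼ f`. -/
def IsInfiniteIdem {R : Type*} [Ring R] (e : R) : Prop :=
  IsIdempotentElem e ∧ ∃ f g : R, IsIdempotentElem f ∧ IsIdempotentElem g ∧
    f * g = 0 ∧ g * f = 0 ∧ e = f + g ∧ g ≠ 0 ∧ IdemEquiv e f

/-- A ring is purely infinite simple if it is simple and every nonzero right ideal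
(submodule of `R` as a right module over itself, i.e. as an `Rᵐᵒᵖ`-module)
contains an infinite idempotent. -/
def PurelyInfiniteSimple (R : Type*) [Ring R] : Prop :=
  IsSimpleRing R ∧ ∀ I : Submodule Rᵐᵒᵖ R, I ≠ ⊥ → ∃ e ∈ I, IsInfiniteIdem e

/-- A module `M` is directly infinite if `M ≅ M ⊕ B` for some nonzero module `B`. -/
def DirectlyInfinite (R : Type u) (M : Type v) [Ring R] [AddCommGroup M] [Module R M] : Prop :=
  ∃ (B : Type v) (_ : AddCommGroup B) (_ : Module R B),
    Nontrivial B ∧ Nonempty (M ≃ₗ[R] M × B)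

set_option linter.unusedSectionVars false
set_option linter.unusedVariables false
set_option linter.unusedSimpArgs false

section Abstract

open CategoryTheory CategoryTheory.Limits

variable {C : Type v} [Category.{u} C] [Preadditive C]

instance homMod (X Y : C) : Module (End X)ᵐᵒᵖ (X ⟶ Y) where
  smul_add r f g := Preadditive.comp_add _ _ _ _ _ _
  smul_zero r := comp_zero
  add_smul r s f := Preadditive.add_comp _ _ _ _ _ _
  zero_smul f := zero_comp

lemma homMod_smul {X Y : C} (r : (End X)ᵐᵒᵖ) (f : X ⟶ Y) :
    r • f = (show X ⟶ X from r.unop) ≫ f := rfl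

/-- postcomposition as a linear map of right modules -/
def postL (X : C) {Y Z : C} (f : Y ⟶ Z) : (X ⟶ Y) →ₗ[(End X)ᵐᵒᵖ] (X ⟶ Z) where
  toFun g := g ≫ f
  map_add' g h := by simp
  map_smul' r g := by simp [homMod_smul]

@[simp] lemma postL_apply (X : C) {Y Z : C} (f : Y ⟶ Z) (g : X ⟶ Y) :
    postL X f g = g ≫ f := rfl

/-- an isomorphism induces a linear equivalence -/
def postE (X : C) {Y Z : C} (f : Y ≅ Z) : (X ⟶ Y) ≃ₗ[(End X)ᵐᵒᵖ] (X ⟶ Z) where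
  toLinearMap := postL X f.hom
  invFun g := g ≫ f.inv
  left_inv g := by simp
  right_inv g := by simp

/-- Hom into a biproduct -/
noncomputable def postProd [HasBinaryBiproducts C] (X Y Z : C) :
    (X ⟶ Y ⊞ Z) ≃ₗ[(End X)ᵐᵒᵖ] (X ⟶ Y) × (X ⟶ Z) where
  toLinearMap := (postL X biprod.fst).prod (postL X biprod.snd)
  invFun g := biprod.lift g.1 g.2
  left_inv g := by apply biprod.hom_ext <;> simp
  right_inv g := by ext <;> simp

/-- The right module `R` over itself as a hom-module -/
def selfE (X : C) : (X ⟶ X) ≃ₗ[(End X)ᵐᵒᵖ] (End X) where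
  toFun f := f
  map_add' _ _ := rfl
  map_smul' _ _ := rfl
  invFun f := f
  left_inv _ := rfl
  right_inv _ := rfl

/-- The right module `R` over itself as the regular left module of the opposite ring -/
def selfOp (R : Type u) [Ring R] : R ≃ₗ[Rᵐᵒᵖ] Rᵐᵒᵖ where
  toFun f := MulOpposite.op f
  map_add' _ _ := rfl
  map_smul' r x := by
    apply MulOpposite.unop_injective
    simp
  invFun f := f.unop
  left_inv _ := rfl
  right_inv _ := rfl

lemma yoneda_retract {X Y Z : C} (s : Y ⟶ X) (r : X ⟶ Y) (h : s ≫ r = 𝟙 Y)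
    (f : (X ⟶ Y) →ₗ[(End X)ᵐᵒᵖ] (X ⟶ Z)) (x : X ⟶ Y) : f x = x ≫ s ≫ f r := by
  have h1 : x = (MulOpposite.op (show End X from x ≫ s)) • r := by
    rw [homMod_smul]
    change x = (x ≫ s) ≫ r
    rw [Category.assoc, h, Category.comp_id]
  conv_lhs => rw [h1]
  rw [map_smul, homMod_smul]
  change (x ≫ s) ≫ f r = _
  rw [Category.assoc]

lemma exists_pow [HasBinaryBiproducts C] (X : C) (hz : ∃ Z : C, 𝟙 Z = 0) (n : ℕ) :
    ∃ Y : C, Nonempty ((X ⟶ Y) ≃ₗ[(End X)ᵐᵒᵖ] (Fin n → (End X)ᵐᵒᵖ)) := by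
  induction n with
  | zero =>
    obtain ⟨Z, hZ⟩ := hz
    refine ⟨Z, ⟨?_⟩⟩
    have : Subsingleton (X ⟶ Z) := ⟨fun a b => by
      rw [← Category.comp_id a, ← Category.comp_id b, hZ, comp_zero, comp_zero]⟩
    exact { (0 : (X ⟶ Z) →ₗ[(End X)ᵐᵒᵖ] (Fin 0 → (End X)ᵐᵒᵖ)) with
      invFun := fun _ => 0
      left_inv := fun _ => Subsingleton.elim _ _
      right_inv := fun _ => Subsingleton.elim _ _ }
  | succ n ih =>
    obtain ⟨Y, ⟨e⟩⟩ := ih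
    exact ⟨X ⊞ Y, ⟨(postProd X X Y).trans
      ((LinearEquiv.prodCongr ((selfE X).trans (selfOp (End X))) e).trans
        (Fin.consLinearEquiv (End X)ᵐᵒᵖ (fun _ : Fin (n+1) => (End X)ᵐᵒᵖ)))⟩⟩

theorem abstract_realization (k : Type u) [Field k] [Linear k C] [HasBinaryBiproducts C]
    (G : Type) [AddCommGroup G] (u₀ : G) (D : C → G)
    (hz : ∃ Z : C, 𝟙 Z = 0)
    (h1 : ∀ {X Y : C} (f : X ⟶ Y), ∃ (U : C) (p : X ⟶ U) (i : U ⟶ Y) (p' : U ⟶ X) (i' : Y ⟶ U),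
      f = p ≫ i ∧ p' ≫ p = 𝟙 U ∧ i ≫ i' = 𝟙 U)
    (h2 : ∀ X Y : C, 𝟙 X ≠ 0 → 𝟙 Y ≠ 0 → D X = D Y → Nonempty (X ≅ Y))
    (h3 : ∀ X Y : C, (X ≅ Y) → D X = D Y)
    (h4 : ∀ X Y : C, D (X ⊞ Y) = D X + D Y)
    (h5 : ∀ g : G, ∃ X : C, 𝟙 X ≠ 0 ∧ D X = g) :
    ∃ (R : Type u) (_ : Ring R) (_ : Algebra k R) (P : G → Type u)
      (_ : ∀ g, AddCommGroup (P g)) (_ : ∀ g, Module Rᵐᵒᵖ (P g)),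
      (∀ a : R, ∃ b : R, a * b * a = a) ∧
      PurelyInfiniteSimple R ∧
      (∀ g : G, Nontrivial (P g) ∧ Module.Finite Rᵐᵒᵖ (P g) ∧ Module.Projective Rᵐᵒᵖ (P g)) ∧
      (∀ g h : G, Nonempty (P (g + h) ≃ₗ[Rᵐᵒᵖ] (P g × P h))) ∧
      Nonempty (P u₀ ≃ₗ[Rᵐᵒᵖ] R) ∧
      (∀ (Q : Type u) [AddCommGroup Q] [Module Rᵐᵒᵖ Q],
        Nontrivial Q → Module.Finite Rᵐᵒᵖ Q → Module.Projective Rᵐᵒᵖ Q →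
          ∃! g : G, Nonempty (Q ≃ₗ[Rᵐᵒᵖ] P g)) := by
  have hsum : ∀ X Y : C, 𝟙 X ≠ 0 → 𝟙 (X ⊞ Y) ≠ 0 := by
    intro X Y hX h
    apply hX
    have : (biprod.inl : X ⟶ X ⊞ Y) ≫ 𝟙 _ ≫ biprod.fst = 𝟙 X := by simp
    rw [← this, h]; simp
  -- decompositions
  have hdec : ∀ X Y : C, 𝟙 X ≠ 0 → 𝟙 Y ≠ 0 → ∃ Z : C, 𝟙 Z ≠ 0 ∧ Nonempty (X ⊞ Z ≅ Y) := by
    intro X Y hX hY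
    obtain ⟨Z, hZ, hd⟩ := h5 (D Y - D X)
    exact ⟨Z, hZ, h2 _ _ (hsum X Z hX) hY (by rw [h4, hd]; abel)⟩
  have hret : ∀ X Y : C, 𝟙 X ≠ 0 → 𝟙 Y ≠ 0 → ∃ (s : X ⟶ Y) (r : Y ⟶ X), s ≫ r = 𝟙 X := by
    intro X Y hX hY
    obtain ⟨Z, -, ⟨e⟩⟩ := hdec X Y hX hY
    exact ⟨biprod.inl ≫ e.hom, e.inv ≫ biprod.fst, by simp⟩
  choose O hO hDO using h5
  let X := O u₀
  have hX : 𝟙 X ≠ 0 := hO u₀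
  have key : ∀ f : X ⟶ X, f ≠ 0 → ∃ a b : X ⟶ X, b ≫ f ≫ a = 𝟙 X := by
    intro f hf
    obtain ⟨U, p, i, p', i', rfl, hp, hi⟩ := h1 f
    have hU : 𝟙 U ≠ 0 := by
      intro h
      apply hf
      rw [← Category.id_comp i, h]; simp
    obtain ⟨s, r, hsr⟩ := hret X U hX hU
    refine ⟨i' ≫ r, s ≫ p', ?_⟩
    simp only [Category.assoc]
    rw [reassoc_of% hi, reassoc_of% hp, hsr]
  have hnt : Nontrivial (End X) := ⟨⟨𝟙 X, 0, hX⟩⟩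
  refine ⟨End X, inferInstance, inferInstance, fun g => (X ⟶ O g), inferInstance,
    fun g => homMod X (O g), ?_, ⟨?_, ?_⟩, ?_, ?_, ⟨selfE X⟩, ?_⟩
  · intro f
    obtain ⟨U, p, i, p', i', h, hp, hi⟩ := h1 (show X ⟶ X from f)
    refine ⟨(i' ≫ p' : X ⟶ X), ?_⟩
    change f ≫ (i' ≫ p') ≫ f = f
    change f = _ at h
    rw [h]
    simp only [Category.assoc]
    rw [reassoc_of% hi, reassoc_of% hp]
  · constructor
    constructor
    intro I
    by_cases hI : I = ⊥
    · exact Or.inl hI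
    right
    have hI' : ∃ f ∈ I, f ≠ 0 := by
      by_contra hc
      push Not at hc
      apply hI
      rw [eq_bot_iff]
      intro f hf
      rw [TwoSidedIdeal.mem_bot]
      exact hc f hf
    obtain ⟨f, hf, hf0⟩ := hI'
    obtain ⟨a, b, hab⟩ := key f hf0
    have : (1 : End X) ∈ I := by
      have h : (1 : End X) = (show End X from a) * f * (show End X from b) := by
        change 𝟙 X = b ≫ f ≫ a
        exact hab.symm
      rw [h]
      exact I.mul_mem_right _ _ (I.mul_mem_left _ _ hf)
    rw [eq_top_iff]
    intro x _
    simpa using I.mul_mem_left x 1 this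
  · intro I hI
    obtain ⟨f, hf, hf0⟩ := Submodule.exists_mem_ne_zero_of_ne_bot hI
    obtain ⟨a, b, hab⟩ := key f hf0
    obtain ⟨Z, hZ, ⟨e⟩⟩ := hdec X X hX hX
    let A : End X := a
    let F : End X := f * (show End X from b)
    have hAF : A * F = 1 := by
      change (b ≫ f) ≫ a = 𝟙 X
      rw [Category.assoc]; exact hab
    let x : End X := (biprod.inl ≫ e.hom : X ⟶ X)
    let y : End X := (e.inv ≫ biprod.fst : X ⟶ X)
    have hyx : y * x = 1 := by
      change (biprod.inl ≫ e.hom) ≫ (e.inv ≫ biprod.fst) = 𝟙 X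
      simp
    have hxy : x * y ≠ 1 := by
      intro h
      change (e.inv ≫ biprod.fst) ≫ (biprod.inl ≫ e.hom) = 𝟙 X at h
      apply hZ
      have h' : (biprod.inr ≫ e.hom) ≫ ((e.inv ≫ biprod.fst) ≫ (biprod.inl ≫ e.hom)) ≫ e.inv ≫
        (biprod.snd : X ⊞ Z ⟶ Z) = 𝟙 Z := by rw [h]; simp
      rw [← h']; simp
    have hAF' : ∀ z, A * (F * z) = z := fun z => by rw [← mul_assoc, hAF, one_mul]
    have hyx' : ∀ z, y * (x * z) = z := fun z => by rw [← mul_assoc, hyx, one_mul]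
    refine ⟨F * A, ?_, ?_, F * x * y * A, F * (1 - x * y) * A, ?_, ?_, ?_, ?_, ?_, ?_,
      F * y * A, F * x * A, ?_, ?_, ?_, ?_⟩
    · have : F * A = MulOpposite.op ((show End X from b) * A) • f := by
        simp [F, mul_assoc]
      rw [this]
      exact I.smul_mem _ hf
    · simp only [IsIdempotentElem, mul_assoc, hAF']
    · simp only [IsIdempotentElem, mul_assoc, hAF', hyx']
    · simp only [IsIdempotentElem, mul_assoc, hAF', hyx', sub_mul, mul_sub, one_mul]; abel
    · simp only [mul_assoc, hAF', hyx', sub_mul, mul_sub, one_mul]; abel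
    · simp only [mul_assoc, hAF', hyx', sub_mul, mul_sub, one_mul]; abel
    · simp only [mul_assoc, sub_mul, mul_sub, one_mul]; abel
    · intro h
      apply hxy
      have h' : A * (F * (1 - x * y) * A) * F = 1 - x * y := by
        simp only [mul_assoc, hAF', hAF, mul_one]
      rw [h] at h'
      simp only [mul_zero, zero_mul] at h'
      exact (sub_eq_zero.mp h'.symm).symm
    · simp only [mul_assoc, hAF', hyx']
    · simp only [mul_assoc, hAF', hyx']
    · simp only [mul_assoc, hAF', hyx']
    · simp only [mul_assoc, hAF', hyx']
  · intro g
    obtain ⟨s, r, hsr⟩ := hret (O g) X (hO g) hX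
    have hfin : Module.Finite (End X)ᵐᵒᵖ (X ⟶ X) :=
      Module.Finite.equiv ((selfE X).trans (selfOp (End X))).symm
    have hproj : Module.Projective (End X)ᵐᵒᵖ (X ⟶ X) :=
      Module.Projective.of_equiv ((selfE X).trans (selfOp (End X))).symm
    refine ⟨⟨⟨r, 0, ?_⟩⟩, ?_, ?_⟩
    · intro h; apply hO g; rw [← hsr, h]; simp
    · exact Module.Finite.of_surjective (postL X r) (fun y => ⟨y ≫ s, by simp [hsr]⟩)
    · exact Module.Projective.of_split (postL X s) (postL X r) (by ext y; simp [hsr])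
  · intro g h
    obtain ⟨e⟩ := h2 (O (g + h)) (O g ⊞ O h) (hO _) (hsum _ _ (hO g)) (by rw [h4, hDO, hDO, hDO])
    exact ⟨(postE X e).trans (postProd X _ _)⟩
  · intro Q _ _ hQ1 hQ2 hQ3
    have huniq : ∀ g h : G, Nonempty ((X ⟶ O g) ≃ₗ[(End X)ᵐᵒᵖ] (X ⟶ O h)) → g = h := by
      rintro g h ⟨e⟩
      obtain ⟨s, r, hsr⟩ := hret (O g) X (hO g) hX
      obtain ⟨s', r', hsr'⟩ := hret (O h) X (hO h) hX
      have e1 := yoneda_retract s r hsr e.toLinearMap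
      have e2 := yoneda_retract s' r' hsr' e.symm.toLinearMap
      rw [← hDO g, ← hDO h]
      apply h3
      simp only [LinearEquiv.coe_coe] at e1 e2
      refine ⟨s ≫ e r, s' ≫ e.symm r', ?_, ?_⟩
      · have : r ≫ (s ≫ e r) ≫ s' ≫ e.symm r' = r := by
          rw [← Category.assoc r, ← e1, ← e2]; simp
        rw [← Category.id_comp ((s ≫ e r) ≫ s' ≫ e.symm r'), ← hsr, Category.assoc, this]
      · have : r' ≫ (s' ≫ e.symm r') ≫ s ≫ e r = r' := by
          rw [← Category.assoc r', ← e2, ← e1]; simp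
        rw [← Category.id_comp ((s' ≫ e.symm r') ≫ s ≫ e r), ← hsr', Category.assoc, this]
    obtain ⟨n, π, hπ⟩ := Module.Finite.exists_fin' (End X)ᵐᵒᵖ Q
    obtain ⟨Y, ⟨ε⟩⟩ := exists_pow X hz n
    obtain ⟨σ, hσ⟩ := Module.projective_lifting_property π LinearMap.id hπ
    let a : Q →ₗ[(End X)ᵐᵒᵖ] (X ⟶ Y) := ε.symm.toLinearMap ∘ₗ σ
    let b : (X ⟶ Y) →ₗ[(End X)ᵐᵒᵖ] Q := π ∘ₗ ε.toLinearMap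
    have hba : ∀ q, b (a q) = q := by
      intro q
      have := LinearMap.congr_fun hσ q
      simpa [a, b] using this
    have hY : 𝟙 Y ≠ 0 := by
      intro h
      obtain ⟨q, hq⟩ := exists_ne (0 : Q)
      apply hq
      rw [← hba q, ← Category.comp_id (a q), h, comp_zero, map_zero]
    obtain ⟨s, r, hsr⟩ := hret Y X hY hX
    have hy := yoneda_retract s r hsr (a ∘ₗ b)
    simp only [LinearMap.comp_apply] at hy
    obtain ⟨U, p, i, p', i', hf, hp, hi⟩ := h1 (s ≫ a (b r))
    rw [hf] at hy
    have hip : i ≫ p = 𝟙 U := by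
      have h1 : (r ≫ p ≫ i) ≫ p ≫ i = r ≫ p ≫ i := by
        rw [← hy, ← hy, hba]
      have h2 : (p' ≫ s) ≫ ((r ≫ p ≫ i) ≫ p ≫ i) ≫ i' = (p' ≫ s) ≫ (r ≫ p ≫ i) ≫ i' := by
        rw [h1]
      simp only [Category.assoc, hi, Category.comp_id, reassoc_of% hsr, reassoc_of% hp, hp] at h2
      exact h2
    let E : Q ≃ₗ[(End X)ᵐᵒᵖ] (X ⟶ U) :=
      { (postL X p) ∘ₗ a with
        invFun := fun z => b (z ≫ i)
        left_inv := fun q => by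
          change b ((a q ≫ p) ≫ i) = q
          rw [Category.assoc, ← hy, hba, hba]
        right_inv := fun z => by
          change a (b (z ≫ i)) ≫ p = z
          rw [hy]; simp [hip] }
    have hU : 𝟙 U ≠ 0 := by
      intro h
      obtain ⟨q, hq⟩ := exists_ne (0 : Q)
      apply hq
      rw [← E.symm_apply_apply q, ← Category.comp_id (E q), h, comp_zero, map_zero]
    obtain ⟨e⟩ := h2 U (O (D U)) hU (hO _) (hDO _).symm
    refine ⟨D U, ⟨E.trans (postE X e)⟩, ?_⟩
    rintro g ⟨e'⟩
    exact huniq _ _ ⟨e'.symm.trans (E.trans (postE X e))⟩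

end Abstract


section Comb

/-- the binary graph attached to a sequence of lists -/
def cgr (T : ℕ → List ℕ) : ℕ ⊕ List ℕ → Bool → ℕ ⊕ List ℕ
  | Sum.inl n, false => Sum.inl n
  | Sum.inl n, true => Sum.inr (T n)
  | Sum.inr [], false => Sum.inr []
  | Sum.inr [], true => Sum.inr (T 0)
  | Sum.inr (a :: _), false => Sum.inl a
  | Sum.inr (_ :: l), true => Sum.inr l

/-- degrees -/
def dgr {G : Type} [AddCommGroup G] (δ : ℕ → G) : ℕ ⊕ List ℕ → G
  | Sum.inl n => δ n
  | Sum.inr l => (l.map δ).sum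

lemma dgr_cgr {G : Type} [AddCommGroup G] (δ : ℕ → G) (T : ℕ → List ℕ)
    (hTz : ∀ n, ((T n).map δ).sum = 0) (v : ℕ ⊕ List ℕ) :
    dgr δ v = dgr δ (cgr T v false) + dgr δ (cgr T v true) := by
  rcases v with n | (_ | ⟨a, l⟩) <;> simp [cgr, dgr, hTz]

/-- expansion of a vertex -/
def xpd : ℕ ⊕ List ℕ → List ℕ
  | Sum.inl n => [n]
  | Sum.inr l => l

lemma exists_T {G : Type} [AddCommGroup G] [Countable G] :
    ∃ (δ : ℕ → G) (T : ℕ → List ℕ), Function.Surjective δ ∧ (∀ n, ((T n).map δ).sum = 0) ∧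
      (∀ n, 0 ∈ T n) ∧ (∀ m, 2 * m + 1 ∈ T (2 * m) ∧ 2 * m + 2 ∈ T (2 * m)) ∧
      (∀ l : List ℕ, 0 ∈ l → (l.map δ).sum = 0 → ∃ n, T n = l) := by
  obtain ⟨δ, hδ⟩ := exists_surjective_nat G
  have hne : Nonempty {l : List ℕ // 0 ∈ l ∧ (l.map δ).sum = 0} := by
    obtain ⟨n, hn⟩ := hδ (-δ 0)
    exact ⟨[0, n], by simp, by simp [hn]⟩
  obtain ⟨s, hs⟩ := exists_surjective_nat {l : List ℕ // 0 ∈ l ∧ (l.map δ).sum = 0}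
  choose c hc using fun m : ℕ => hδ (-(δ 0 + δ (2 * m + 1) + δ (2 * m + 2)))
  let T : ℕ → List ℕ := fun n =>
    if n % 2 = 0 then [0, 2 * (n / 2) + 1, 2 * (n / 2) + 2, c (n / 2)] else (s (n / 2)).1
  have hT0 : ∀ m, T (2 * m) = [0, 2 * m + 1, 2 * m + 2, c m] := by
    intro m; simp [T]
  have hT1 : ∀ m, T (2 * m + 1) = (s m).1 := by
    intro m
    have h1 : (2 * m + 1) / 2 = m := by omega
    have h2 : (2 * m + 1) % 2 ≠ 0 := by omega
    simp only [T, h1, if_neg h2]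
  refine ⟨δ, T, hδ, ?_, ?_, ?_, ?_⟩
  · intro n
    rcases Nat.even_or_odd' n with ⟨m, rfl | rfl⟩
    · rw [hT0]; simp [hc]
    · rw [hT1]; exact (s m).2.2
  · intro n
    rcases Nat.even_or_odd' n with ⟨m, rfl | rfl⟩
    · rw [hT0]; simp
    · rw [hT1]; exact (s m).2.1
  · intro m
    rw [hT0]; simp
  · intro l h0 hl
    obtain ⟨m, hm⟩ := hs ⟨l, h0, hl⟩
    exact ⟨2 * m + 1, by rw [hT1, hm]⟩

lemma comb {G : Type} [AddCommGroup G] (δ : ℕ → G) (T : ℕ → List ℕ) (hδ : Function.Surjective δ)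
    (hTz : ∀ n, ((T n).map δ).sum = 0)
    (hT0 : ∀ n, 0 ∈ T n) (hTc : ∀ m, 2 * m + 1 ∈ T (2 * m) ∧ 2 * m + 2 ∈ T (2 * m))
    (hTs : ∀ l : List ℕ, 0 ∈ l → (l.map δ).sum = 0 → ∃ n, T n = l)
    {M : Type*} [AddCommMonoid M] (x : ℕ ⊕ List ℕ → M)
    (hx : ∀ v, x v = x (cgr T v false) + x (cgr T v true))
    (S S' : Multiset (ℕ ⊕ List ℕ)) (hS : S ≠ 0) (hS' : S' ≠ 0)
    (hd : (S.map (dgr δ)).sum = (S'.map (dgr δ)).sum) :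
    (S.map x).sum = (S'.map x).sum := by
  let X : ℕ → M := fun n => x (Sum.inl n)
  let y : List ℕ → M := fun l => x (Sum.inr l)
  let o := y []
  have hX : ∀ n, X n = X n + y (T n) := fun n => hx (Sum.inl n)
  have ho : o = o + y (T 0) := hx (Sum.inr [])
  have hyc : ∀ a l, y (a :: l) = X a + y l := fun a l => hx (Sum.inr (a :: l))
  have hy : ∀ l, y l = (l.map X).sum + o := by
    intro l
    induction l with
    | nil => simp [o]
    | cons a l ih => rw [hyc, ih, List.map_cons, List.sum_cons, add_assoc]
  let le : M → M → Prop := fun a b => ∃ c, b = a + c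
  have le_trans : ∀ {a b c}, le a b → le b c → le a c := by
    rintro a b c ⟨p, rfl⟩ ⟨q, rfl⟩
    exact ⟨p + q, by rw [add_assoc]⟩
  have le_add : ∀ {a b} c, le a b → le a (b + c) := by
    rintro a b c ⟨p, rfl⟩
    exact ⟨p + c, by rw [add_assoc]⟩
  have le_add' : ∀ {a b} c, le a b → le a (c + b) := by
    intro a b c h; rw [add_comm]; exact le_add c h
  have le_refl : ∀ a, le a a := fun a => ⟨0, by simp⟩
  have le_mem : ∀ (l : List ℕ) a, a ∈ l → le (X a) (l.map X).sum := by
    intro l a ha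
    rw [((List.perm_cons_erase ha).map X).sum_eq, List.map_cons, List.sum_cons]
    exact le_add _ (le_refl _)
  let h := X 0
  have hhy : ∀ n, le h (y (T n)) := by
    intro n
    rw [hy]
    exact le_add _ (le_mem _ _ (hT0 n))
  have hhX : ∀ n, le h (X n) := by
    intro n
    rw [hX n]
    exact le_add' _ (hhy n)
  have hho : le h o := by
    rw [ho]; exact le_add' _ (hhy 0)
  have hhyl : ∀ l, le h (y l) := by
    intro l
    rw [hy]; exact le_add' _ hho
  have hXh : ∀ n, le (X n) h := by
    intro n
    induction n using Nat.strong_induction_on with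
    | _ n ih =>
      rcases Nat.eq_zero_or_pos n with rfl | hn
      · exact le_refl _
      obtain ⟨m, hm, hlt⟩ : ∃ m, n ∈ T (2 * m) ∧ 2 * m < n := by
        rcases Nat.even_or_odd' n with ⟨m, rfl | rfl⟩
        · refine ⟨m - 1, ?_, by omega⟩
          have := (hTc (m - 1)).2
          have e : 2 * (m - 1) + 2 = 2 * m := by omega
          rwa [e] at this
        · exact ⟨m, (hTc m).1, by omega⟩
      refine le_trans ?_ (ih _ hlt)
      rw [hX (2 * m), hy]
      exact le_add' _ (le_add _ (le_mem _ _ hm))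
  have absorb : ∀ z, le h z → ∀ n, z + y (T n) = z := by
    intro z hz n
    obtain ⟨c, rfl⟩ := le_trans (hXh n) hz
    rw [add_right_comm, ← hX n]
  let E := y (T 0)
  have hE : ∀ n, y (T n) = E := by
    intro n
    rw [← absorb (y (T n)) (hhy n) 0, add_comm, absorb _ (hhy 0)]
  have hzE : ∀ z, le h z → z + E = z := fun z hz => absorb z hz 0
  have hsumE : ∀ l : List ℕ, l ≠ [] → (l.map δ).sum = 0 → (l.map X).sum = E := by
    intro l hl hl0
    obtain ⟨n, hn⟩ := hTs (l ++ T 0) (by simp [hT0]) (by simp [hl0, hTz])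
    have h1 : (l.map X).sum + E = E := by
      have := hE n
      rw [hn, hy, List.map_append, List.sum_append, add_assoc, ← hy] at this
      exact this
    rw [← h1, hzE]
    obtain ⟨a, ha⟩ := List.exists_mem_of_ne_nil l hl
    exact le_trans (hhX a) (le_mem l a ha)
  have hoE : o = E := by
    have h1 : E = E + o := by
      have h2 := hsumE (T 0) (List.ne_nil_of_mem (hT0 0)) (hTz 0)
      conv_lhs => rw [show E = y (T 0) from rfl, hy, h2]
    rw [h1, add_comm, hzE o hho]
  have hEE : E + E = E := hzE E (hhy 0)
  have hxp : ∀ v, x v + E = ((xpd v).map X).sum + E := by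
    rintro (n | l)
    · simp [xpd, X]
    · change y l + E = _
      rw [hy, hoE, add_assoc, hEE]; rfl
  have hdx : ∀ v, dgr δ v = ((xpd v).map δ).sum := by
    rintro (n | l) <;> simp [dgr, xpd]
  have hxS : ∀ S : Multiset (ℕ ⊕ List ℕ), ∃ l : List ℕ,
      (S.map x).sum + E = (l.map X).sum + E ∧ (S.map (dgr δ)).sum = (l.map δ).sum := by
    intro S
    induction S using Multiset.induction_on with
    | empty => exact ⟨[], by simp, by simp⟩
    | cons v S ih =>
      obtain ⟨l, h1, h2⟩ := ih
      refine ⟨xpd v ++ l, ?_, ?_⟩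
      · rw [Multiset.map_cons, Multiset.sum_cons, add_assoc, h1, add_left_comm, hxp,
          List.map_append, List.sum_append]
        abel
      · rw [Multiset.map_cons, Multiset.sum_cons, h2, hdx, List.map_append, List.sum_append]
  have hhv : ∀ v, le h (x v) := by
    rintro (n | l)
    · exact hhX n
    · exact hhyl l
  have hhS : ∀ S : Multiset (ℕ ⊕ List ℕ), S ≠ 0 → le h (S.map x).sum := by
    intro S hS
    obtain ⟨v, hv⟩ := Multiset.exists_mem_of_ne_zero hS
    obtain ⟨S, rfl⟩ := Multiset.exists_cons_of_mem hv
    rw [Multiset.map_cons, Multiset.sum_cons]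
    exact le_add _ (hhv v)
  obtain ⟨l, h1, h2⟩ := hxS S
  obtain ⟨l', h1', h2'⟩ := hxS S'
  rw [hzE _ (hhS S hS)] at h1
  rw [hzE _ (hhS S' hS')] at h1'
  rw [h1, h1']
  obtain ⟨n, hn⟩ := hδ (-(l.map δ).sum)
  have e1 := hsumE (l ++ [n]) (by simp) (by simp [hn])
  have e2 := hsumE (l' ++ [n]) (by simp) (by simp [hn, ← h2', ← hd, h2])
  simp only [List.map_append, List.sum_append, List.map_cons, List.map_nil, List.sum_cons,
    List.sum_nil, add_zero] at e1 e2
  calc (l.map X).sum + E = (l.map X).sum + ((l'.map X).sum + X n) := by rw [e2]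
    _ = (l'.map X).sum + ((l.map X).sum + X n) := by rw [add_left_comm]
    _ = _ := by rw [e1]

end Comb



section Conc
open CategoryTheory CategoryTheory.Limits

abbrev Sp (k : Type u) [Field k] (ι : Type) : Type u := (ι × List Bool) →₀ k

section lin
open Classical
variable {k : Type u} [Field k] {V : Type} (c : V → Bool → V) {ι κ μ : Type}

theorem app_inj (b : Bool) : Function.Injective
    (fun p : ι × List Bool => ((p.1, p.2 ++ [b]) : ι × List Bool)) := by
  intro p q h
  simp only [Prod.mk.injEq, List.append_cancel_right_eq] at h
  exact Prod.ext h.1 h.2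

noncomputable def Lop (S : ι → V) (v : V) (b : Bool) : Sp k ι →ₗ[k] Sp k ι where
  toFun x := (x.comapDomain (fun p : ι × List Bool => (p.1, p.2 ++ [b]))
    (app_inj b).injOn).filter (fun p => p.2.foldl c (S p.1) = v)
  map_add' x y := by
    ext p; simp only [Finsupp.filter_apply, Finsupp.comapDomain_apply, Finsupp.add_apply]
    split_ifs <;> simp
  map_smul' a x := by
    ext p; simp only [Finsupp.filter_apply, Finsupp.comapDomain_apply, Finsupp.smul_apply,
      RingHom.id_apply]
    split_ifs <;> simp

theorem Lop_apply (S : ι → V) (v : V) (b : Bool) (x : Sp k ι) (i : ι) (w : List Bool) :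
    Lop c S v b x (i, w) = if w.foldl c (S i) = v then x (i, w ++ [b]) else 0 := by
  simp [Lop, Finsupp.filter_apply]

/-- finitely supported functions on words of length less than m -/
def Wm (k : Type u) [Field k] (ι : Type) (m : ℕ) : Submodule k (Sp k ι) :=
  Finsupp.supported k k {p | p.2.length < m}

theorem mem_Wm {m : ℕ} {x : Sp k ι} :
    x ∈ Wm k ι m ↔ ∀ i w, m ≤ List.length w → x (i, w) = 0 := by
  rw [Wm, Finsupp.mem_supported']
  constructor
  · intro h i w hw
    exact h (i, w) (by simpa using hw)
  · rintro h ⟨i, w⟩ hw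
    exact h i w (by simpa using hw)

theorem Wm_mono {m n : ℕ} (h : m ≤ n) : Wm k ι m ≤ Wm k ι n := by
  intro x hx
  rw [mem_Wm] at *
  exact fun i w hw => hx i w (h.trans hw)

theorem Wm_zero {x : Sp k ι} : x ∈ Wm k ι 0 ↔ x = 0 := by
  rw [mem_Wm]
  constructor
  · intro h; ext ⟨i, w⟩; exact h i w (Nat.zero_le _)
  · rintro rfl; simp

theorem exists_Wm (x : Sp k ι) : ∃ m, x ∈ Wm k ι m := by
  refine ⟨x.support.sup (fun p => p.2.length) + 1, ?_⟩
  rw [mem_Wm]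
  intro i w hw
  by_contra hne
  have := Finset.le_sup (f := fun p : ι × List Bool => p.2.length) (Finsupp.mem_support_iff.2 hne)
  simp only at this
  omega

theorem Wm_finite [Finite ι] (m : ℕ) : {p : ι × List Bool | p.2.length < m}.Finite := by
  have h : {w : List Bool | w.length < m}.Finite := List.finite_length_lt Bool m
  exact (Set.Finite.prod (Set.finite_univ (α := ι)) h).subset (fun p hp => ⟨trivial, hp⟩)

theorem map_Wm [Finite ι] (φ : Sp k ι →ₗ[k] Sp k κ) (m : ℕ) :
    ∃ n, ∀ x ∈ Wm k ι m, φ x ∈ Wm k κ n := by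
  choose f hf using fun p : ι × List Bool => exists_Wm (φ (Finsupp.single p 1))
  refine ⟨(Wm_finite (ι := ι) m).toFinset.sup f, ?_⟩
  have : Wm k ι m ≤ (Wm k κ ((Wm_finite (ι := ι) m).toFinset.sup f)).comap φ := by
    rw [Wm, Finsupp.supported_eq_span_single, Submodule.span_le]
    rintro _ ⟨p, hp, rfl⟩
    exact Wm_mono (Finset.le_sup (f := f) (by simpa using hp)) (hf p)
  exact this

theorem Lop_Wm (S : ι → V) (v b) {m : ℕ} {x : Sp k ι} (hx : x ∈ Wm k ι (m+1)) :
    Lop c S v b x ∈ Wm k ι m := by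
  rw [mem_Wm] at *
  intro i w hw
  rw [Lop_apply]
  split_ifs
  · exact hx _ _ (by simpa using hw)
  · rfl

theorem Wm_succ_of (S : ι → V) {m : ℕ} {x : Sp k ι}
    (hx : ∀ v b, Lop c S v b x ∈ Wm k ι m) : x ∈ Wm k ι (m+1) := by
  rw [mem_Wm]
  intro i w hw
  rcases List.eq_nil_or_concat w with rfl | ⟨w, b, rfl⟩
  · simp at hw
  · have := mem_Wm.1 (hx (w.foldl c (S i)) b) i w (by simpa using hw)
    rw [Lop_apply, if_pos rfl] at this
    simpa using this

def Ex (S : ι → V) (T : κ → V) (φ : Sp k ι →ₗ[k] Sp k κ) : Prop :=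
  ∀ v b x, φ (Lop c S v b x) = Lop c T v b (φ x)

def Df (S : ι → V) (T : κ → V) (m : ℕ) (φ : Sp k ι →ₗ[k] Sp k κ) : Prop :=
  ∀ v b x, φ (Lop c S v b x) - Lop c T v b (φ x) ∈ Wm k κ m

variable {c}

theorem Df_zero {S : ι → V} {T : κ → V} {φ : Sp k ι →ₗ[k] Sp k κ} :
    Df c S T 0 φ ↔ Ex c S T φ := by
  simp [Df, Ex, Wm_zero, sub_eq_zero]

theorem Df.mono {S : ι → V} {T : κ → V} {φ : Sp k ι →ₗ[k] Sp k κ} {m n : ℕ} (h : Df c S T m φ)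
    (hmn : m ≤ n) : Df c S T n φ := fun v b x => Wm_mono hmn (h v b x)

theorem Ex.comp {S : ι → V} {T : κ → V} {U : μ → V} {φ : Sp k ι →ₗ[k] Sp k κ}
    {ψ : Sp k κ →ₗ[k] Sp k μ} (hψ : Ex c T U ψ) (hφ : Ex c S T φ) : Ex c S U (ψ ∘ₗ φ) := by
  intro v b x; simp [hφ v b x, hψ v b (φ x)]

theorem Ex.sub {S : ι → V} {T : κ → V} {φ ψ : Sp k ι →ₗ[k] Sp k κ}
    (hφ : Ex c S T φ) (hψ : Ex c S T ψ) : Ex c S T (φ - ψ) := by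
  intro v b x; simp [hφ v b x, hψ v b x]

theorem Ex.map_Wm {S : ι → V} {T : κ → V} {φ : Sp k ι →ₗ[k] Sp k κ}
    (hφ : Ex c S T φ) (m : ℕ) : ∀ x ∈ Wm k ι m, φ x ∈ Wm k κ m := by
  induction m with
  | zero => intro x hx; rw [Wm_zero] at *; simp [hx]
  | succ m ih =>
    intro x hx
    apply Wm_succ_of c T
    intro v b
    rw [← hφ]
    exact ih _ (Lop_Wm c S v b hx)

/-! inclusions and projections -/

noncomputable def inc (e : ι → κ) : Sp k ι →ₗ[k] Sp k κ :=
  Finsupp.lmapDomain k k (Prod.map e id)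

noncomputable def prj (e : ι → κ) (he : Function.Injective e) : Sp k κ →ₗ[k] Sp k ι :=
  Finsupp.lcomapDomain (Prod.map e id) (he.prodMap Function.injective_id)

theorem inc_apply (e : ι → κ) (he : Function.Injective e) (x : Sp k ι) (i w) :
    inc e x (e i, w) = x (i, w) := by
  have := Finsupp.mapDomain_apply (he.prodMap (Function.injective_id (α := List Bool))) x (i, w)
  simpa [inc] using this

theorem inc_apply_not (e : ι → κ) (x : Sp k ι) (j w) (hj : j ∉ Set.range e) :
    inc e x (j, w) = 0 := by
  have := Finsupp.mapDomain_of_notMem_range (f := Prod.map e (id : List Bool → List Bool)) x (j, w)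
    (by rintro ⟨⟨i, w'⟩, h⟩; simp at h; exact hj ⟨i, h.1⟩)
  simpa [inc] using this

theorem prj_apply (e : ι → κ) (he : Function.Injective e) (y : Sp k κ) (i w) :
    prj e he y (i, w) = y (e i, w) := by
  simp [prj, Finsupp.lcomapDomain]

theorem prj_inc (e : ι → κ) (he : Function.Injective e) (x : Sp k ι) :
    prj e he (inc e x) = x := by
  ext ⟨i, w⟩; rw [prj_apply, inc_apply e he]

theorem prj_inc_ne (e : ι → κ) (he : Function.Injective e) (e' : μ → κ)
    (h : ∀ i j, e i ≠ e' j) (x : Sp k μ) : prj e he (inc e' x) = 0 := by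
  ext ⟨i, w⟩; rw [prj_apply, inc_apply_not]; · rfl
  rintro ⟨j, hj⟩; exact h i j hj.symm

theorem inc_prj_add (e : ι → κ) (he : Function.Injective e) (e' : μ → κ)
    (he' : Function.Injective e')
    (h : ∀ i j, e i ≠ e' j) (hs : ∀ l, l ∈ Set.range e ∨ l ∈ Set.range e') (x : Sp k κ) :
    inc e (prj e he x) + inc e' (prj e' he' x) = x := by
  ext ⟨l, w⟩
  rcases hs l with ⟨i, rfl⟩ | ⟨i, rfl⟩
  · rw [Finsupp.add_apply, inc_apply e he, prj_apply, inc_apply_not, add_zero]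
    rintro ⟨j, hj⟩; exact h i j hj.symm
  · rw [Finsupp.add_apply, inc_apply e' he', prj_apply, inc_apply_not, zero_add]
    rintro ⟨j, hj⟩; exact h j i hj

theorem inc_prj (e : ι → κ) (he : Function.Bijective e) (x : Sp k κ) :
    inc e (prj e he.1 x) = x := by
  ext ⟨l, w⟩
  obtain ⟨i, rfl⟩ := he.2 l
  rw [inc_apply e he.1, prj_apply]

theorem inc_ex (e : ι → κ) (he : Function.Injective e) (S : ι → V) (T : κ → V)
    (hT : ∀ i, T (e i) = S i) : Ex c S T (inc (k := k) e) := by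
  intro v b x
  ext ⟨l, w⟩
  rw [Lop_apply]
  by_cases hl : l ∈ Set.range e
  · obtain ⟨i, rfl⟩ := hl
    rw [inc_apply e he, inc_apply e he, Lop_apply, hT]
  · rw [inc_apply_not e _ _ _ hl, inc_apply_not e _ _ _ hl]; simp

theorem prj_ex (e : ι → κ) (he : Function.Injective e) (S : ι → V) (T : κ → V)
    (hT : ∀ i, T (e i) = S i) : Ex c T S (prj (k := k) e he) := by
  intro v b x
  ext ⟨i, w⟩
  rw [Lop_apply, prj_apply, Lop_apply, prj_apply, hT]

/-! the shift -/

def sg (c : V → Bool → V) (S : ι → V) : ι × Bool → V := fun p => c (S p.1) p.2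

theorem sh_inj : Function.Injective
    (fun q : (ι × Bool) × List Bool => ((q.1.1, q.1.2 :: q.2) : ι × List Bool)) := by
  rintro ⟨⟨i, b⟩, w⟩ ⟨⟨j, b'⟩, w'⟩ h
  simp at h
  simp [h]

noncomputable def piM : Sp k ι →ₗ[k] Sp k (ι × Bool) :=
  Finsupp.lcomapDomain (fun q => (q.1.1, q.1.2 :: q.2)) sh_inj

noncomputable def tauM : Sp k (ι × Bool) →ₗ[k] Sp k ι :=
  Finsupp.lmapDomain k k (fun q => (q.1.1, q.1.2 :: q.2))

theorem piM_apply (x : Sp k ι) (i b w) : piM x ((i, b), w) = x (i, b :: w) := by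
  simp [piM, Finsupp.lcomapDomain]

theorem tauM_cons (y : Sp k (ι × Bool)) (i b w) : tauM y (i, b :: w) = y ((i, b), w) := by
  have := Finsupp.mapDomain_apply (sh_inj (ι := ι)) y ((i, b), w)
  simpa [tauM] using this

theorem tauM_nil (y : Sp k (ι × Bool)) (i) : tauM y (i, []) = 0 := by
  have := Finsupp.mapDomain_of_notMem_range (f := (fun q : (ι × Bool) × List Bool => ((q.1.1, q.1.2 :: q.2) : ι × List Bool))) y (i, [])
    (by rintro ⟨⟨i, w'⟩, h⟩; simp at h)
  simpa [tauM] using this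

theorem piM_ex (S : ι → V) : Ex c S (sg c S) (piM (k := k)) := by
  intro v b x
  ext ⟨⟨i, b'⟩, w⟩
  rw [Lop_apply, piM_apply, Lop_apply, piM_apply]
  rfl

theorem piM_tauM (y : Sp k (ι × Bool)) : piM (tauM y) = y := by
  ext ⟨⟨i, b'⟩, w⟩
  rw [piM_apply, tauM_cons]

theorem tauM_piM (x : Sp k ι) : x - tauM (piM x) ∈ Wm k ι 1 := by
  rw [mem_Wm]
  intro i w hw
  cases w with
  | nil => simp at hw
  | cons b w => rw [Finsupp.sub_apply, tauM_cons, piM_apply, sub_self]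

theorem piM_eq_zero {x : Sp k ι} (h : piM x = 0) : x ∈ Wm k ι 1 := by
  have := tauM_piM x
  rwa [h, map_zero, sub_zero] at this

theorem piM_Wm {m : ℕ} {x : Sp k ι} (hx : x ∈ Wm k ι (m+1)) : piM x ∈ Wm k (ι × Bool) m := by
  rw [mem_Wm] at *
  rintro ⟨i, b⟩ w hw
  rw [piM_apply]
  exact hx _ _ (by simpa using hw)

theorem tauM_df (S : ι → V) : Df c (sg c S) S 1 (tauM (k := k)) := by
  intro v b y
  rw [mem_Wm]
  intro i w hw
  cases w with
  | nil => simp at hw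
  | cons b' w =>
    rw [Finsupp.sub_apply, tauM_cons, Lop_apply, Lop_apply, sub_eq_zero, List.cons_append,
      tauM_cons]
    rfl

theorem Ex.factor {S : ι → V} {T : κ → V} {φ : Sp k ι →ₗ[k] Sp k κ} (hφ : Ex c S T φ)
    (h1 : ∀ x ∈ Wm k ι 1, φ x = 0) : Ex c (sg c S) T (φ ∘ₗ tauM) ∧ (φ ∘ₗ tauM) ∘ₗ piM = φ := by
  refine ⟨fun v b y => ?_, ?_⟩
  · have := h1 _ (tauM_df (c := c) S v b y |> fun h => h)
    rw [map_sub, sub_eq_zero, hφ] at this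
    exact this
  · ext1 p
    ext1
    have := h1 _ (tauM_piM (Finsupp.single p (1 : k)))
    rw [map_sub, sub_eq_zero] at this
    simp [this]

theorem Df.pi {S : ι → V} {T : κ → V} {φ : Sp k ι →ₗ[k] Sp k κ} {m : ℕ} (h : Df c S T (m+1) φ) :
    Df c S (sg c T) m (piM ∘ₗ φ) := by
  intro v b x
  have := piM_Wm (h v b x)
  rw [map_sub, piM_ex T] at this
  exact this

/-- single-vertex endomorphisms -/
theorem single_vertex {s t : V} {a : Sp k Unit →ₗ[k] Sp k Unit}
    (ha : Ex c (fun _ => s) (fun _ => t) a) (h0 : a (Finsupp.single ((), []) 1) ((), []) ≠ 0) :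
    s = t ∧ ∃ a' : Sp k Unit →ₗ[k] Sp k Unit, Ex c (fun _ => t) (fun _ => s) a' ∧
      a ∘ₗ a' = LinearMap.id ∧ a' ∘ₗ a = LinearMap.id := by
  have hinj : ∀ m, ∀ x ∈ Wm k Unit m, a x = 0 → x = 0 := by
    intro m
    induction m with
    | zero => intro x hx _; exact Wm_zero.1 hx
    | succ m ih =>
      intro x hx hax
      have h1 : x ∈ Wm k Unit 1 := by
        apply Wm_succ_of c (fun _ => s)
        intro v b
        rw [Wm_zero]
        apply ih _ (Lop_Wm c _ v b hx)
        rw [ha, hax, map_zero]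
      have h2 : x = x ((), []) • Finsupp.single ((), []) 1 := by
        ext ⟨⟨⟩, w⟩
        cases w with
        | nil => simp
        | cons b w =>
          rw [mem_Wm.1 h1 _ _ (by simp)]
          simp
      rw [h2, map_smul] at hax
      have h3 := DFunLike.congr_fun hax ((), [])
      simp only [Finsupp.smul_apply, smul_eq_mul, Finsupp.coe_zero, Pi.zero_apply, mul_eq_zero,
        h0, or_false] at h3
      rw [h2, h3, zero_smul]
  have hI : Function.Injective a := by
    rw [injective_iff_map_eq_zero]
    intro x hx
    obtain ⟨m, hm⟩ := exists_Wm x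
    exact hinj m x hm hx
  have hS : Function.Surjective a := by
    intro y
    obtain ⟨m, hm⟩ := exists_Wm y
    have : FiniteDimensional k (Wm k Unit m) := by
      rw [Wm, Finsupp.supported_eq_span_single]
      exact FiniteDimensional.span_of_finite k ((Wm_finite m).image _)
    let a1 : Wm k Unit m →ₗ[k] Wm k Unit m := a.restrict (ha.map_Wm m)
    have : Function.Surjective a1 := by
      refine LinearMap.surjective_of_injective (K := k) (V := Wm k Unit m) (f := a1) ?_
      intro x x' h
      exact Subtype.ext (hI (congrArg Subtype.val h))
    obtain ⟨x, hx⟩ := this ⟨y, hm⟩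
    exact ⟨x, congrArg Subtype.val hx⟩
  have hst : s = t := by
    have h1 := ha s false (Finsupp.single ((), [false]) 1)
    have h2 : Lop c (fun _ => s) s false (Finsupp.single ((), [false]) (1:k)) =
        (Finsupp.single ((), []) 1 : Sp k Unit) := by
      ext ⟨⟨⟩, w⟩
      rw [Lop_apply]
      cases w <;> simp
    rw [h2] at h1
    rw [h1, Lop_apply] at h0
    by_contra hne
    exact h0 (if_neg (fun h => hne h.symm))
  let E := LinearEquiv.ofBijective a ⟨hI, hS⟩
  refine ⟨hst, E.symm.toLinearMap, ?_, ?_, ?_⟩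
  · intro v b x
    apply hI
    have h1 : ∀ y, a (E.symm y) = y := fun y => E.apply_symm_apply y
    show a (E.symm _) = a (Lop c _ v b (E.symm x))
    rw [ha, h1, h1]
  · ext1 p; ext1; exact E.apply_symm_apply _
  · ext1 p; ext1; exact E.symm_apply_apply _

end lin

section cat
variable {k : Type u} [Field k] {V : Type} {c : V → Bool → V}

structure Fm (k : Type u) (c : V → Bool → V) : Type 1 where
  ι : Type
  fin : Finite ι
  S : ι → V

attribute [instance] Fm.fin

def LM (k : Type u) [Field k] (a b : Type) : Type u := Sp k a →ₗ[k] Sp k b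

noncomputable instance lmGrp (a b : Type) : AddCommGroup (LM k a b) :=
  inferInstanceAs (AddCommGroup (Sp k a →ₗ[k] Sp k b))

noncomputable instance lmMod (a b : Type) : Module k (LM k a b) :=
  { smul := fun r (f : Sp k a →ₗ[k] Sp k b) => (r • f : Sp k a →ₗ[k] Sp k b)
    one_smul := fun f => one_smul k (show Sp k a →ₗ[k] Sp k b from f)
    mul_smul := fun x y f => mul_smul x y (show Sp k a →ₗ[k] Sp k b from f)
    smul_zero := fun x => smul_zero (A := Sp k a →ₗ[k] Sp k b) x
    zero_smul := fun f => zero_smul k (show Sp k a →ₗ[k] Sp k b from f)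
    smul_add := fun x f g => smul_add x (show Sp k a →ₗ[k] Sp k b from f)
      (show Sp k a →ₗ[k] Sp k b from g)
    add_smul := fun x y f => add_smul x y (show Sp k a →ₗ[k] Sp k b from f) }

def IsG (X Y : Fm k c) (φ : Sp k X.ι →ₗ[k] Sp k Y.ι) : Prop := ∃ m, Df c X.S Y.S m φ

theorem IsG.add {X Y : Fm k c} {φ ψ : Sp k X.ι →ₗ[k] Sp k Y.ι} :
    IsG X Y φ → IsG X Y ψ → IsG X Y (φ + ψ) := by
  rintro ⟨m, hm⟩ ⟨n, hn⟩
  refine ⟨max m n, fun v b x => ?_⟩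
  have := Submodule.add_mem _ (Wm_mono (le_max_left m n) (hm v b x))
    (Wm_mono (le_max_right m n) (hn v b x))
  convert this using 1
  simp only [LinearMap.add_apply, map_add]
  abel

theorem IsG.smul {X Y : Fm k c} (a : k) {φ : Sp k X.ι →ₗ[k] Sp k Y.ι} :
    IsG X Y φ → IsG X Y (a • φ) := by
  rintro ⟨m, hm⟩
  refine ⟨m, fun v b x => ?_⟩
  have := Submodule.smul_mem _ a (hm v b x)
  convert this using 1
  simp [smul_sub]

theorem IsG.zero {X Y : Fm k c} : IsG X Y 0 := ⟨0, fun v b x => by simp⟩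

theorem IsG.sub {X Y : Fm k c} {φ ψ : Sp k X.ι →ₗ[k] Sp k Y.ι}
    (hφ : IsG X Y φ) (hψ : IsG X Y ψ) : IsG X Y (φ - ψ) := by
  obtain ⟨m, hm⟩ := hφ
  obtain ⟨n, hn⟩ := hψ
  refine ⟨max m n, fun v b x => ?_⟩
  have := Submodule.sub_mem _ (Wm_mono (le_max_left m n) (hm v b x))
    (Wm_mono (le_max_right m n) (hn v b x))
  convert this using 1
  simp only [LinearMap.sub_apply, map_sub]
  abel

theorem IsG.comp {X Y Z : Fm k c} {φ : Sp k X.ι →ₗ[k] Sp k Y.ι} {ψ : Sp k Y.ι →ₗ[k] Sp k Z.ι}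
    (hφ : IsG X Y φ) (hψ : IsG Y Z ψ) : IsG X Z (ψ ∘ₗ φ) := by
  obtain ⟨m, hm⟩ := hφ
  obtain ⟨n, hn⟩ := hψ
  obtain ⟨l, hl⟩ := map_Wm ψ m
  refine ⟨max l n, fun v b x => ?_⟩
  have := Submodule.add_mem _ (Wm_mono (le_max_left l n) (hl _ (hm v b x)))
    (Wm_mono (le_max_right l n) (hn v b (φ x)))
  convert this using 1
  simp

def IsF (X Y : Fm k c) (φ : Sp k X.ι →ₗ[k] Sp k Y.ι) : Prop := ∃ m, ∀ x, φ x ∈ Wm k Y.ι m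

theorem IsF.add {X Y : Fm k c} {φ ψ : Sp k X.ι →ₗ[k] Sp k Y.ι} :
    IsF X Y φ → IsF X Y ψ → IsF X Y (φ + ψ) := by
  rintro ⟨m, hm⟩ ⟨n, hn⟩
  exact ⟨max m n, fun x => Submodule.add_mem _ (Wm_mono (le_max_left m n) (hm x))
      (Wm_mono (le_max_right m n) (hn x))⟩

theorem IsF.post {X Y Z : Fm k c} {φ : Sp k X.ι →ₗ[k] Sp k Y.ι} (ψ : Sp k Y.ι →ₗ[k] Sp k Z.ι)
    (hφ : IsF X Y φ) : IsF X Z (ψ ∘ₗ φ) := by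
  obtain ⟨m, hm⟩ := hφ
  obtain ⟨l, hl⟩ := map_Wm ψ m
  exact ⟨l, fun x => hl _ (hm x)⟩

theorem IsF.pre {X Y Z : Fm k c} (φ : Sp k X.ι →ₗ[k] Sp k Y.ι) {ψ : Sp k Y.ι →ₗ[k] Sp k Z.ι}
    (hψ : IsF Y Z ψ) : IsF X Z (ψ ∘ₗ φ) := by
  obtain ⟨m, hm⟩ := hψ
  exact ⟨m, fun x => hm _⟩

def germ (X Y : Fm k c) : Submodule k (LM k X.ι Y.ι) where
  carrier := {φ | IsG X Y φ}
  add_mem' := fun h h' => IsG.add h h'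
  zero_mem' := IsG.zero
  smul_mem' := fun a _ h => IsG.smul a h

def finG (X Y : Fm k c) : Submodule k (germ X Y) where
  carrier := {φ | IsF X Y φ.1}
  add_mem' := fun h h' => IsF.add h h'
  zero_mem' := ⟨0, fun x => Submodule.zero_mem _⟩
  smul_mem' := by
    rintro a φ ⟨m, hm⟩
    exact ⟨m, fun x => Submodule.smul_mem _ a (hm x)⟩

noncomputable def gcomp {X Y Z : Fm k c} (φ : germ X Y) (ψ : germ Y Z) : germ X Z :=
  ⟨(show Sp k Y.ι →ₗ[k] Sp k Z.ι from ψ.1) ∘ₗ (show Sp k X.ι →ₗ[k] Sp k Y.ι from φ.1),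
    IsG.comp φ.2 ψ.2⟩

abbrev QHom (X Y : Fm k c) : Type u := germ X Y ⧸ finG X Y

theorem gcomp_rel {X Y Z : Fm k c} {φ φ' : germ X Y} {ψ ψ' : germ Y Z}
    (h1 : φ - φ' ∈ finG X Y) (h2 : ψ - ψ' ∈ finG Y Z) :
    gcomp φ ψ - gcomp φ' ψ' ∈ finG X Z := by
  have h3 := (IsF.post (show Sp k Y.ι →ₗ[k] Sp k Z.ι from ψ.1) h1).add
    (IsF.pre (show Sp k X.ι →ₗ[k] Sp k Y.ι from φ'.1) h2)
  obtain ⟨m, hm⟩ := h3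
  refine ⟨m, fun x => ?_⟩
  have h4 := hm x
  have e1 : (show Sp k X.ι →ₗ[k] Sp k Z.ι from (gcomp φ ψ - gcomp φ' ψ').1) x =
    (show Sp k Y.ι →ₗ[k] Sp k Z.ι from ψ.1) ((show Sp k X.ι →ₗ[k] Sp k Y.ι from φ.1) x) -
    (show Sp k Y.ι →ₗ[k] Sp k Z.ι from ψ'.1) ((show Sp k X.ι →ₗ[k] Sp k Y.ι from φ'.1) x) := rfl
  have e2 : (show Sp k Y.ι →ₗ[k] Sp k Z.ι from ψ.1)
      ((show Sp k X.ι →ₗ[k] Sp k Y.ι from φ.1) x - (show Sp k X.ι →ₗ[k] Sp k Y.ι from φ'.1) x) +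
      ((show Sp k Y.ι →ₗ[k] Sp k Z.ι from ψ.1) ((show Sp k X.ι →ₗ[k] Sp k Y.ι from φ'.1) x) -
      (show Sp k Y.ι →ₗ[k] Sp k Z.ι from ψ'.1) ((show Sp k X.ι →ₗ[k] Sp k Y.ι from φ'.1) x))
      ∈ Wm k Z.ι m := h4
  rw [map_sub] at e2
  show (show Sp k X.ι →ₗ[k] Sp k Z.ι from (gcomp φ ψ - gcomp φ' ψ').1) x ∈ Wm k Z.ι m
  rw [e1]
  convert e2 using 1
  abel

noncomputable def qcomp {X Y Z : Fm k c} (f : QHom X Y) (g : QHom Y Z) : QHom X Z :=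
  Quotient.map₂ gcomp (by
    intro φ φ' h ψ ψ' h'
    exact (Submodule.quotientRel_def _).2 (gcomp_rel ((Submodule.quotientRel_def _).1 h)
      ((Submodule.quotientRel_def _).1 h'))) f g

noncomputable def qmk {X Y : Fm k c} (φ : Sp k X.ι →ₗ[k] Sp k Y.ι) (hφ : IsG X Y φ) : QHom X Y :=
  Submodule.Quotient.mk ⟨φ, hφ⟩

theorem qmk_eq {X Y : Fm k c} {φ ψ : Sp k X.ι →ₗ[k] Sp k Y.ι} {hφ : IsG X Y φ}
    {hψ : IsG X Y ψ} : qmk φ hφ = qmk ψ hψ ↔ ∃ m, ∀ x, φ x - ψ x ∈ Wm k Y.ι m := by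
  unfold qmk
  rw [Submodule.Quotient.eq]
  rfl

theorem qmk_surj {X Y : Fm k c} (f : QHom X Y) : ∃ φ hφ, f = qmk φ hφ := by
  obtain ⟨φ, rfl⟩ := Submodule.Quotient.mk_surjective _ f
  exact ⟨φ.1, φ.2, rfl⟩

theorem qcomp_mk {X Y Z : Fm k c} {φ : Sp k X.ι →ₗ[k] Sp k Y.ι} {ψ : Sp k Y.ι →ₗ[k] Sp k Z.ι}
    (hφ : IsG X Y φ) (hψ : IsG Y Z ψ) :
    qcomp (qmk φ hφ) (qmk ψ hψ) = qmk (ψ ∘ₗ φ) (hφ.comp hψ) := rfl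

theorem qmk_add {X Y : Fm k c} {φ ψ : Sp k X.ι →ₗ[k] Sp k Y.ι} (hφ : IsG X Y φ)
    (hψ : IsG X Y ψ) : qmk φ hφ + qmk ψ hψ = qmk (φ + ψ) (hφ.add hψ) := rfl

theorem qmk_sub {X Y : Fm k c} {φ ψ : Sp k X.ι →ₗ[k] Sp k Y.ι} (hφ : IsG X Y φ)
    (hψ : IsG X Y ψ) : qmk φ hφ - qmk ψ hψ = qmk (φ - ψ) (hφ.sub hψ) := rfl

theorem qmk_smul {X Y : Fm k c} (a : k) {φ : Sp k X.ι →ₗ[k] Sp k Y.ι} (hφ : IsG X Y φ) :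
    a • qmk φ hφ = qmk (a • φ) (hφ.smul a) := rfl

theorem qmk_zero {X Y : Fm k c} (h : IsG X Y 0) :
    qmk 0 h = (0 : QHom X Y) := rfl

theorem Ex.isG {X Y : Fm k c} {φ : Sp k X.ι →ₗ[k] Sp k Y.ι} (h : Ex c X.S Y.S φ) :
    IsG X Y φ := ⟨0, Df_zero.2 h⟩

theorem id_germ (X : Fm k c) : IsG X X LinearMap.id :=
  ⟨0, fun v b x => by simp⟩

noncomputable instance fmCat : Category.{u} (Fm k c) where
  Hom X Y := QHom X Y
  id X := qmk LinearMap.id (id_germ X)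
  comp f g := qcomp f g
  id_comp f := by obtain ⟨φ, hφ, rfl⟩ := qmk_surj f; rfl
  comp_id f := by obtain ⟨φ, hφ, rfl⟩ := qmk_surj f; rfl
  assoc f g h := by
    obtain ⟨φ, hφ, rfl⟩ := qmk_surj f
    obtain ⟨ψ, hψ, rfl⟩ := qmk_surj g
    obtain ⟨χ, hχ, rfl⟩ := qmk_surj h
    rfl

noncomputable def qm {X Y : Fm k c} (φ : Sp k X.ι →ₗ[k] Sp k Y.ι) (hφ : IsG X Y φ) : X ⟶ Y := qmk φ hφ

noncomputable instance fmPre : Preadditive (Fm k c) where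
  homGroup X Y := inferInstanceAs (AddCommGroup (QHom X Y))
  add_comp X Y Z f g h := by
    obtain ⟨φ, hφ, rfl⟩ := qmk_surj f
    obtain ⟨ψ, hψ, rfl⟩ := qmk_surj g
    obtain ⟨χ, hχ, rfl⟩ := qmk_surj h
    show qcomp (qmk φ hφ + qmk ψ hψ) (qmk χ hχ) = qcomp (qmk φ hφ) (qmk χ hχ) + qcomp (qmk ψ hψ) (qmk χ hχ)
    rw [qmk_add, qcomp_mk, qcomp_mk, qcomp_mk, qmk_add, qmk_eq]
    exact ⟨0, fun x => by simp⟩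
  comp_add X Y Z f g h := by
    obtain ⟨φ, hφ, rfl⟩ := qmk_surj f
    obtain ⟨ψ, hψ, rfl⟩ := qmk_surj g
    obtain ⟨χ, hχ, rfl⟩ := qmk_surj h
    show qcomp (qmk φ hφ) (qmk ψ hψ + qmk χ hχ) = qcomp (qmk φ hφ) (qmk ψ hψ) + qcomp (qmk φ hφ) (qmk χ hχ)
    rw [qmk_add, qcomp_mk, qcomp_mk, qcomp_mk, qmk_add, qmk_eq]
    exact ⟨0, fun x => by simp⟩

noncomputable instance fmLin : Linear k (Fm k c) where
  homModule X Y := inferInstanceAs (Module k (QHom X Y))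
  smul_comp X Y Z a f g := by
    obtain ⟨φ, hφ, rfl⟩ := qmk_surj f
    obtain ⟨ψ, hψ, rfl⟩ := qmk_surj g
    show qcomp (a • qmk φ hφ) (qmk ψ hψ) = a • qcomp (qmk φ hφ) (qmk ψ hψ)
    rw [qmk_smul, qcomp_mk, qcomp_mk, qmk_smul, qmk_eq]
    exact ⟨0, fun x => by simp⟩
  comp_smul X Y Z f a g := by
    obtain ⟨φ, hφ, rfl⟩ := qmk_surj f
    obtain ⟨ψ, hψ, rfl⟩ := qmk_surj g
    show qcomp (qmk φ hφ) (a • qmk ψ hψ) = a • qcomp (qmk φ hφ) (qmk ψ hψ)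
    rw [qmk_smul, qcomp_mk, qcomp_mk, qmk_smul, qmk_eq]
    exact ⟨0, fun x => by simp⟩

theorem qm_surj {X Y : Fm k c} (f : X ⟶ Y) : ∃ φ hφ, f = qm φ hφ := qmk_surj f

theorem qm_eq {X Y : Fm k c} {φ ψ : Sp k X.ι →ₗ[k] Sp k Y.ι} {hφ : IsG X Y φ}
    {hψ : IsG X Y ψ} : qm φ hφ = qm ψ hψ ↔ ∃ m, ∀ x, φ x - ψ x ∈ Wm k Y.ι m := qmk_eq

theorem qm_eq' {X Y : Fm k c} {φ ψ : Sp k X.ι →ₗ[k] Sp k Y.ι} {hφ : IsG X Y φ}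
    {hψ : IsG X Y ψ} (h : ∀ x, φ x = ψ x) : qm φ hφ = qm ψ hψ :=
  qm_eq.2 ⟨0, fun x => by simp [h]⟩

theorem qm_comp {X Y Z : Fm k c} {φ : Sp k X.ι →ₗ[k] Sp k Y.ι} {ψ : Sp k Y.ι →ₗ[k] Sp k Z.ι}
    (hφ : IsG X Y φ) (hψ : IsG Y Z ψ) :
    qm φ hφ ≫ qm ψ hψ = qm (ψ ∘ₗ φ) (hφ.comp hψ) := rfl

theorem qm_add {X Y : Fm k c} {φ ψ : Sp k X.ι →ₗ[k] Sp k Y.ι} (hφ : IsG X Y φ)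
    (hψ : IsG X Y ψ) : qm φ hφ + qm ψ hψ = qm (φ + ψ) (hφ.add hψ) := rfl

theorem qm_sub {X Y : Fm k c} {φ ψ : Sp k X.ι →ₗ[k] Sp k Y.ι} (hφ : IsG X Y φ)
    (hψ : IsG X Y ψ) : qm φ hφ - qm ψ hψ = qm (φ - ψ) (hφ.sub hψ) := rfl

theorem qm_zero {X Y : Fm k c} (h : IsG X Y 0) :
    qm 0 h = 0 := rfl

theorem qm_id (X : Fm k c) : 𝟙 X = qm LinearMap.id (id_germ X) := rfl

theorem id_eq_zero {X : Fm k c} : 𝟙 X = 0 ↔ IsEmpty X.ι := by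
  rw [qm_id, ← qm_zero IsG.zero, qm_eq]
  constructor
  · rintro ⟨m, hm⟩
    refine ⟨fun i => ?_⟩
    have := mem_Wm.1 (hm (Finsupp.single (i, List.replicate m false) 1)) i
      (List.replicate m false) (by simp)
    simp at this
  · intro h
    refine ⟨0, fun x => ?_⟩
    rw [mem_Wm]
    exact fun i => h.elim i

/-! biproducts -/

structure Cpl {X Y Z : Fm k c} (e : X.ι → Z.ι) (e' : Y.ι → Z.ι) : Prop where
  inj : Function.Injective e
  inj' : Function.Injective e'
  ne : ∀ i j, e i ≠ e' j
  cov : ∀ l, l ∈ Set.range e ∨ l ∈ Set.range e'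
  hS : ∀ i, Z.S (e i) = X.S i
  hS' : ∀ i, Z.S (e' i) = Y.S i

noncomputable def Cpl.bic {X Y Z : Fm k c} {e : X.ι → Z.ι} {e' : Y.ι → Z.ι} (h : Cpl e e') :
    BinaryBicone X Y where
  pt := Z
  fst := qm (prj e h.inj) (prj_ex e h.inj _ _ h.hS).isG
  snd := qm (prj e' h.inj') (prj_ex e' h.inj' _ _ h.hS').isG
  inl := qm (inc e) (inc_ex e h.inj _ _ h.hS).isG
  inr := qm (inc e') (inc_ex e' h.inj' _ _ h.hS').isG
  inl_fst := qm_eq' (fun x => by simp [prj_inc])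
  inl_snd := qm_eq' (ψ := 0) (hψ := IsG.zero)
    (fun x => by simp [prj_inc_ne e' h.inj' e (fun i j => (h.ne j i).symm)])
  inr_fst := qm_eq' (ψ := 0) (hψ := IsG.zero)
    (fun x => by simp [prj_inc_ne e h.inj e' h.ne])
  inr_snd := qm_eq' (fun x => by simp [prj_inc])

theorem Cpl.total {X Y Z : Fm k c} {e : X.ι → Z.ι} {e' : Y.ι → Z.ι} (h : Cpl e e') :
    h.bic.fst ≫ h.bic.inl + h.bic.snd ≫ h.bic.inr = 𝟙 h.bic.pt :=
  qm_eq' (fun x => inc_prj_add e h.inj e' h.inj' h.ne h.cov x)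

def sumF (X Y : Fm k c) : Fm k c := ⟨X.ι ⊕ Y.ι, inferInstance, Sum.elim X.S Y.S⟩

theorem sum_cpl (X Y : Fm k c) : Cpl (X := X) (Y := Y) (Z := sumF X Y) Sum.inl Sum.inr where
  inj := Sum.inl_injective
  inj' := Sum.inr_injective
  ne := fun i j h => Sum.inl_ne_inr h
  cov := by
    rintro (l | l)
    · exact Or.inl ⟨l, rfl⟩
    · exact Or.inr ⟨l, rfl⟩
  hS := fun _ => rfl
  hS' := fun _ => rfl

instance fmBip : HasBinaryBiproducts (Fm k c) :=
  ⟨fun X Y => hasBinaryBiproduct_of_total (sum_cpl X Y).bic (sum_cpl X Y).total⟩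

noncomputable def Cpl.iso {X Y Z : Fm k c} {e : X.ι → Z.ι} {e' : Y.ι → Z.ι} (h : Cpl e e') :
    Z ≅ X ⊞ Y := biprod.uniqueUpToIso X Y (isBinaryBilimitOfTotal h.bic h.total)

/-- reindexing -/
noncomputable def reix {X Y : Fm k c} (e : X.ι → Y.ι) (he : Function.Bijective e)
    (hS : ∀ i, Y.S (e i) = X.S i) : X ≅ Y where
  hom := qm (inc e) (inc_ex e he.1 _ _ hS).isG
  inv := qm (prj e he.1) (prj_ex e he.1 _ _ hS).isG
  hom_inv_id := qm_eq' (fun x => prj_inc e he.1 x)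
  inv_hom_id := qm_eq' (fun x => inc_prj e he x)

def sgF (X : Fm k c) : Fm k c := ⟨X.ι × Bool, inferInstance, sg c X.S⟩

noncomputable def piI (X : Fm k c) : X ≅ sgF X where
  hom := qm (Y := sgF X) piM (Ex.isG (Y := sgF X) (piM_ex X.S))
  inv := qm (X := sgF X) tauM ⟨1, tauM_df X.S⟩
  hom_inv_id := qm_eq.2 ⟨1, fun x => by
    have := Submodule.neg_mem _ (tauM_piM x)
    rwa [neg_sub] at this⟩
  inv_hom_id := qm_eq' (fun x => piM_tauM x)

end cat

section gauss
variable {C : Type v} [Category.{u} C]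

def Fact' {X Y : C} (f : X ⟶ Y) : Prop :=
  ∃ (U : C) (p : X ⟶ U) (i : U ⟶ Y) (p' : U ⟶ X) (i' : Y ⟶ U),
    f = p ≫ i ∧ p' ≫ p = 𝟙 U ∧ i ≫ i' = 𝟙 U

theorem Fact'.iso {X Y X' Y' : C} (a : X' ≅ X) {f : X ⟶ Y} (b : Y ≅ Y') (h : Fact' f) :
    Fact' (a.hom ≫ f ≫ b.hom) := by
  obtain ⟨U, p, i, p', i', rfl, h1, h2⟩ := h
  refine ⟨U, a.hom ≫ p, i ≫ b.hom, p' ≫ a.inv, b.inv ≫ i', by simp, by simp [h1], by simp [h2]⟩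

variable [Preadditive C] [HasBinaryBiproducts C]

theorem Fact'.map {X Y X' Y' : C} (a : X ⟶ Y) [IsIso a] {g : X' ⟶ Y'} (h : Fact' g) :
    Fact' (biprod.map a g) := by
  obtain ⟨U, p, i, p', i', rfl, h1, h2⟩ := h
  refine ⟨Y ⊞ U, biprod.map a p, biprod.map (𝟙 _) i, biprod.map (inv a) p', biprod.map (𝟙 _) i',
    ?_, ?_, ?_⟩
  · ext <;> simp
  · ext <;> simp [h1]
  · ext <;> simp [h2]

theorem gauss_elim {A X B Y : C} (F : A ⊞ X ⟶ B ⊞ Y) (f₁₁ : A ⟶ B) (f₁₂ : A ⟶ Y) (f₂₁ : X ⟶ B)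
    (f₂₂ : X ⟶ Y) (h11 : biprod.inl ≫ F ≫ biprod.fst = f₁₁)
    (h12 : biprod.inl ≫ F ≫ biprod.snd = f₁₂)
    (h21 : biprod.inr ≫ F ≫ biprod.fst = f₂₁)
    (h22 : biprod.inr ≫ F ≫ biprod.snd = f₂₂) (q : B ⟶ A) (hq : f₁₁ ≫ q = 𝟙 _)
    (hq' : q ≫ f₁₁ = 𝟙 _) :
    (Fact' (f₂₂ - f₂₁ ≫ q ≫ f₁₂) → Fact' F) ∧ (IsIso F → IsIso (f₂₂ - f₂₁ ≫ q ≫ f₁₂)) := by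
  have : IsIso f₁₁ := ⟨q, hq, hq'⟩
  have hinv : inv f₁₁ = q := IsIso.inv_eq_of_hom_inv_id hq
  have hF : F = Biprod.ofComponents f₁₁ f₁₂ f₂₁ f₂₂ := by
    rw [← h11, ← h12, ← h21, ← h22, Biprod.ofComponents_eq]
  have key : ∃ (L : A ⊞ X ≅ A ⊞ X) (R : B ⊞ Y ≅ B ⊞ Y),
      L.hom ≫ F ≫ R.hom = biprod.map f₁₁ (f₂₂ - f₂₁ ≫ q ≫ f₁₂) := by
    rw [hF, ← hinv]
    exact ⟨(Biprod.gaussian' f₁₁ f₁₂ f₂₁ f₂₂).1, (Biprod.gaussian' f₁₁ f₁₂ f₂₁ f₂₂).2.1,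
      (Biprod.gaussian' f₁₁ f₁₂ f₂₁ f₂₂).2.2.2⟩
  obtain ⟨L, R, w⟩ := key
  constructor
  · intro h
    have := (h.map f₁₁).iso L.symm R.symm
    rw [← w] at this
    simpa using this
  · intro h
    have : IsIso (biprod.map f₁₁ (f₂₂ - f₂₁ ≫ q ≫ f₁₂)) := by
      rw [← w]; infer_instance
    exact isIso_right_of_isIso_biprod_map f₁₁ _

theorem bic_elim {A X B Y : C} (hX : BinaryBicone A X)
    (tX : hX.fst ≫ hX.inl + hX.snd ≫ hX.inr = 𝟙 hX.pt) (hY : BinaryBicone B Y)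
    (tY : hY.fst ≫ hY.inl + hY.snd ≫ hY.inr = 𝟙 hY.pt) (f : hX.pt ⟶ hY.pt) (q : B ⟶ A)
    (hq : (hX.inl ≫ f ≫ hY.fst) ≫ q = 𝟙 _)
    (hq' : q ≫ (hX.inl ≫ f ≫ hY.fst) = 𝟙 _) (g : X ⟶ Y)
    (hg : g = hX.inr ≫ f ≫ hY.snd -
      (hX.inr ≫ f ≫ hY.fst) ≫ q ≫ (hX.inl ≫ f ≫ hY.snd)) :
    (Fact' g → Fact' f) ∧ (IsIso f → IsIso g) := by
  let iX := biprod.uniqueUpToIso A X (isBinaryBilimitOfTotal hX tX)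
  let iY := biprod.uniqueUpToIso B Y (isBinaryBilimitOfTotal hY tY)
  have e1 : biprod.inl ≫ iX.inv = hX.inl := by
    simp [iX, biprod.uniqueUpToIso_inv]
  have e2 : biprod.inr ≫ iX.inv = hX.inr := by
    simp [iX, biprod.uniqueUpToIso_inv]
  have e3 : iY.hom ≫ biprod.fst = hY.fst := by
    simp [iY, biprod.uniqueUpToIso_hom]
  have e4 : iY.hom ≫ biprod.snd = hY.snd := by
    simp [iY, biprod.uniqueUpToIso_hom]
  obtain ⟨h1, h2⟩ := gauss_elim (iX.inv ≫ f ≫ iY.hom) (hX.inl ≫ f ≫ hY.fst)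
    (hX.inl ≫ f ≫ hY.snd) (hX.inr ≫ f ≫ hY.fst) (hX.inr ≫ f ≫ hY.snd)
    (by rw [← e1, ← e3]; simp only [Category.assoc]) (by rw [← e1, ← e4]; simp only [Category.assoc])
    (by rw [← e2, ← e3]; simp only [Category.assoc])
    (by rw [← e2, ← e4]; simp only [Category.assoc]) q hq hq'
  rw [← hg] at h1 h2
  constructor
  · intro h
    have := (h1 h).iso iX iY.symm
    simpa using this
  · intro h
    apply h2
    infer_instance

end gauss

section good
variable {k : Type u} [Field k] {V : Type} {c : V → Bool → V} {G : Type} [AddCommGroup G]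

theorem Cpl.elim {A X' X B Y' Y : Fm k c} {eA : A.ι → X.ι} {eX : X'.ι → X.ι} {eB : B.ι → Y.ι}
    {eY : Y'.ι → Y.ι} (hX : Cpl eA eX) (hY : Cpl eB eY) (f : X ⟶ Y) (q : B ⟶ A)
    (hq : (hX.bic.inl ≫ f ≫ hY.bic.fst) ≫ q = 𝟙 _)
    (hq' : q ≫ (hX.bic.inl ≫ f ≫ hY.bic.fst) = 𝟙 _) (g : X' ⟶ Y')
    (hg : g = hX.bic.inr ≫ f ≫ hY.bic.snd -
      (hX.bic.inr ≫ f ≫ hY.bic.fst) ≫ q ≫ (hX.bic.inl ≫ f ≫ hY.bic.snd)) :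
    (Fact' g → Fact' f) ∧ (IsIso f → IsIso g) :=
  bic_elim hX.bic hX.total hY.bic hY.total f q hq hq' g hg

noncomputable def Dg (d : V → G) (X : Fm k c) : G := ∑ᶠ i, d (X.S i)

theorem Dg_bij (d : V → G) {X Y : Fm k c} (e : X.ι → Y.ι) (he : Function.Bijective e)
    (hS : ∀ i, Y.S (e i) = X.S i) : Dg d X = Dg d Y :=
  finsum_eq_of_bijective e he (fun i => by rw [hS])

theorem fs_sum {α β : Type} [Finite α] [Finite β] (f : α ⊕ β → G) :
    ∑ᶠ i, f i = ∑ᶠ i, f (Sum.inl i) + ∑ᶠ i, f (Sum.inr i) := by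
  have := Fintype.ofFinite α
  have := Fintype.ofFinite β
  rw [finsum_eq_sum_of_fintype, finsum_eq_sum_of_fintype, finsum_eq_sum_of_fintype,
    Fintype.sum_sum_type]

theorem fs_prod {α : Type} [Finite α] (f : α × Bool → G) :
    ∑ᶠ i, f i = ∑ᶠ i, (f (i, false) + f (i, true)) := by
  have := Fintype.ofFinite α
  rw [finsum_eq_sum_of_fintype, finsum_eq_sum_of_fintype, Fintype.sum_prod_type]
  exact Finset.sum_congr rfl (fun i _ => by rw [Fintype.sum_bool, add_comm])

theorem Dg_sum (d : V → G) (X Y : Fm k c) : Dg d (sumF X Y) = Dg d X + Dg d Y :=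
  fs_sum (fun i : X.ι ⊕ Y.ι => d (Sum.elim X.S Y.S i))

theorem Dg_cpl (d : V → G) {X Y Z : Fm k c} {e : X.ι → Z.ι} {e' : Y.ι → Z.ι} (h : Cpl e e') :
    Dg d Z = Dg d X + Dg d Y := by
  rw [← Dg_sum]
  refine (Dg_bij d (X := sumF X Y) (Y := Z) (Sum.elim e e') ⟨?_, ?_⟩ ?_).symm
  · exact h.inj.sumElim h.inj' h.ne
  · intro l
    rcases h.cov l with ⟨i, rfl⟩ | ⟨i, rfl⟩
    · exact ⟨Sum.inl i, rfl⟩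
    · exact ⟨Sum.inr i, rfl⟩
  · rintro (i | i)
    · exact h.hS i
    · exact h.hS' i

theorem Dg_sg (d : V → G) (hd : ∀ v, d v = d (c v false) + d (c v true)) (X : Fm k c) :
    Dg d (sgF X) = Dg d X := by
  refine (fs_prod (fun p : X.ι × Bool => d (sg c X.S p))).trans ?_
  exact finsum_congr (fun i => (hd (X.S i)).symm)

theorem Dg_empty (d : V → G) (X : Fm k c) (h : IsEmpty X.ι) : Dg d X = 0 := by
  rw [Dg, finsum_of_isEmpty]

def Good (d : V → G) {X Y : Fm k c} (f : X ⟶ Y) : Prop := Fact' f ∧ (IsIso f → Dg d X = Dg d Y)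

theorem Good.pre {d : V → G} {X X' Y : Fm k c} (a : X' ≅ X) (h : Dg d X' = Dg d X) {f : X ⟶ Y}
    (hf : Good d f) : Good d (a.hom ≫ f) := by
  refine ⟨by simpa using hf.1.iso a (Iso.refl _), fun hi => ?_⟩
  rw [h]
  exact hf.2 (by
    have : f = a.inv ≫ a.hom ≫ f := by simp
    rw [this]; infer_instance)

theorem Good.of_post {d : V → G} {X Y Y' : Fm k c} (a : Y ≅ Y') (h : Dg d Y = Dg d Y')
    {f : X ⟶ Y} (hf : Good d (f ≫ a.hom)) : Good d f := by
  refine ⟨by simpa using hf.1.iso (Iso.refl _) a.symm, fun hi => ?_⟩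
  rw [h]
  exact hf.2 inferInstance

theorem good_zero (d : V → G) (X Y : Fm k c) : Good d (0 : X ⟶ Y) := by
  refine ⟨⟨⟨Empty, inferInstance, Empty.elim⟩, 0, 0, 0, 0, by simp, ?_, ?_⟩, fun hi => ?_⟩
  · rw [id_eq_zero.2 (inferInstanceAs (IsEmpty Empty))]; simp
  · rw [id_eq_zero.2 (inferInstanceAs (IsEmpty Empty))]; simp
  · have h1 : 𝟙 X = 0 := by
      have := IsIso.hom_inv_id (0 : X ⟶ Y)
      rw [zero_comp] at this
      exact this.symm
    have h2 : 𝟙 Y = 0 := by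
      have := IsIso.inv_hom_id (0 : X ⟶ Y)
      rw [comp_zero] at this
      exact this.symm
    rw [Dg_empty d X (id_eq_zero.1 h1), Dg_empty d Y (id_eq_zero.1 h2)]

def one (X : Fm k c) (i : X.ι) : Fm k c := ⟨Unit, inferInstance, fun _ => X.S i⟩
def oth (X : Fm k c) (i : X.ι) : Fm k c := ⟨{j // j ≠ i}, inferInstance, fun j => X.S j⟩

theorem one_cpl (X : Fm k c) (i : X.ι) :
    Cpl (X := one X i) (Y := oth X i) (Z := X) (fun _ => i) Subtype.val where
  inj := fun _ _ _ => rfl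
  inj' := Subtype.val_injective
  ne := fun _ j h => j.2 h.symm
  cov := fun l => by
    by_cases h : l = i
    · exact Or.inl ⟨(), h.symm⟩
    · exact Or.inr ⟨⟨l, h⟩, rfl⟩
  hS := fun _ => rfl
  hS' := fun _ => rfl

theorem exists_i0 {X Y : Fm k c} {φ : Sp k X.ι →ₗ[k] Sp k Y.ι} (hφ : Ex c X.S Y.S φ)
    {y : Sp k X.ι} (hy : y ∈ Wm k X.ι 1) (hne : φ y ≠ 0) :
    ∃ i j, φ (Finsupp.single (i, []) 1) (j, []) ≠ 0 := by
  by_contra hcon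
  push Not at hcon
  apply hne
  have : Wm k X.ι 1 ≤ LinearMap.ker φ := by
    rw [Wm, Finsupp.supported_eq_span_single, Submodule.span_le]
    rintro _ ⟨⟨i, w⟩, hp, rfl⟩
    have hw : w = [] := by
      have : w.length < 1 := hp
      exact List.length_eq_zero_iff.1 (by omega)
    subst hw
    show φ _ = 0
    have h1 := hφ.map_Wm 1 (Finsupp.single (i, []) 1) (by
      rw [mem_Wm]
      intro i' w hw
      cases w with
      | nil => simp at hw
      | cons b w => simp)
    ext ⟨j, w⟩
    cases w with
    | nil => exact hcon i j
    | cons b w => exact mem_Wm.1 h1 j _ (by simp)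
  exact this hy

theorem good_elim (d : V → G) {A X' X B Y' Y : Fm k c} {eA : A.ι → X.ι} {eX : X'.ι → X.ι}
    {eB : B.ι → Y.ι} {eY : Y'.ι → Y.ι} (hX : Cpl eA eX) (hY : Cpl eB eY)
    (φ : Sp k X.ι →ₗ[k] Sp k Y.ι) (h : Ex c X.S Y.S φ)
    (a' : Sp k B.ι →ₗ[k] Sp k A.ι) (ha' : Ex c B.S A.S a')
    (h1 : ∀ x, a' (prj eB hY.inj (φ (inc eA x))) = x)
    (h2 : ∀ x, prj eB hY.inj (φ (inc eA (a' x))) = x) (hD : Dg d A = Dg d B)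
    (IH : ∀ (φ' : Sp k X'.ι →ₗ[k] Sp k Y'.ι) (h' : Ex c X'.S Y'.S φ'), Good d (qm φ' h'.isG)) :
    Good d (qm φ h.isG) := by
  have exA := inc_ex (k := k) (c := c) _ hX.inj _ _ hX.hS
  have exX := inc_ex (k := k) (c := c) _ hX.inj' _ _ hX.hS'
  have exB := prj_ex (k := k) (c := c) _ hY.inj _ _ hY.hS
  have exY := prj_ex (k := k) (c := c) _ hY.inj' _ _ hY.hS'
  have e12 := exY.comp (h.comp exA)
  have e21 := exB.comp (h.comp exX)
  have e22 := exY.comp (h.comp exX)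
  have eg := e22.sub (e12.comp (ha'.comp e21))
  have hg := IH _ eg
  have hq : (hX.bic.inl ≫ qm φ h.isG ≫ hY.bic.fst) ≫ qm a' ha'.isG = 𝟙 _ := by
    show (qm (inc eA) exA.isG ≫ qm φ h.isG ≫ qm (prj eB hY.inj) exB.isG) ≫ qm a' ha'.isG = 𝟙 _
    rw [qm_id, qm_comp, qm_comp, qm_comp]
    exact qm_eq' h1
  have hq' : qm a' ha'.isG ≫ (hX.bic.inl ≫ qm φ h.isG ≫ hY.bic.fst) = 𝟙 _ := by
    show qm a' ha'.isG ≫ (qm (inc eA) exA.isG ≫ qm φ h.isG ≫ qm (prj eB hY.inj) exB.isG) = 𝟙 _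
    rw [qm_id, qm_comp, qm_comp, qm_comp]
    exact qm_eq' h2
  obtain ⟨E1, E2⟩ := Cpl.elim hX hY (qm φ h.isG) (qm a' ha'.isG) hq hq' (qm _ eg.isG) (by
    show _ = (qm (inc eX) exX.isG ≫ qm φ h.isG ≫ qm (prj eY hY.inj') exY.isG) -
      (qm (inc eX) exX.isG ≫ qm φ h.isG ≫ qm (prj eB hY.inj) exB.isG) ≫ qm a' ha'.isG ≫
      (qm (inc eA) exA.isG ≫ qm φ h.isG ≫ qm (prj eY hY.inj') exY.isG)
    simp only [qm_comp, qm_sub]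
    exact qm_eq' (fun x => rfl))
  refine ⟨E1 hg.1, fun hi => ?_⟩
  rw [Dg_cpl d hX, Dg_cpl d hY, hg.2 (E2 hi), hD]

theorem vertex_inv {ι κ : Type} {S : ι → V} {T : κ → V} {φ : Sp k ι →ₗ[k] Sp k κ}
    (h : Ex c S T φ) (i : ι) (j : κ) (hij : φ (Finsupp.single (i, []) 1) (j, []) ≠ 0)
    (hi : Function.Injective (fun _ : Unit => j)) :
    S i = T j ∧ ∃ a' : Sp k Unit →ₗ[k] Sp k Unit, Ex c (fun _ => T j) (fun _ => S i) a' ∧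
      (∀ x, a' (prj (fun _ : Unit => j) hi (φ (inc (fun _ : Unit => i) x))) = x) ∧
      (∀ x, prj (fun _ : Unit => j) hi (φ (inc (fun _ : Unit => i) (a' x))) = x) := by
  have exA : Ex c (fun _ => S i) S (inc (k := k) (fun _ : Unit => i)) :=
    inc_ex _ (fun _ _ _ => rfl) _ _ (fun _ => rfl)
  have exB : Ex c T (fun _ => T j) (prj (k := k) (fun _ : Unit => j) hi) :=
    prj_ex _ _ _ _ (fun _ => rfl)
  obtain ⟨hst, a', ha', haa', ha'a⟩ := single_vertex (exB.comp (h.comp exA)) (by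
      simp only [LinearMap.comp_apply]
      rw [prj_apply]
      have : inc (k := k) (fun _ : Unit => i) (Finsupp.single ((), []) 1) =
          Finsupp.single (i, []) 1 := by
        simp [inc, Finsupp.mapDomain_single]
      rw [this]
      exact hij)
  exact ⟨hst, a', ha', fun x => DFunLike.congr_fun ha'a x, fun x => DFunLike.congr_fun haa' x⟩

theorem good_block (d : V → G) {X Y : Fm k c}
    (φ : Sp k X.ι →ₗ[k] Sp k Y.ι) (h : Ex c X.S Y.S φ) (i : X.ι) (j : Y.ι)
    (hij : φ (Finsupp.single (i, []) 1) (j, []) ≠ 0)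
    (IH : ∀ (φ' : Sp k (oth X i).ι →ₗ[k] Sp k (oth Y j).ι) (h' : Ex c (oth X i).S (oth Y j).S φ'),
      Good d (qm φ' h'.isG)) :
    Good d (qm φ h.isG) := by
  obtain ⟨hst, a', ha', h1, h2⟩ := vertex_inv h i j hij (fun _ _ _ => rfl)
  refine good_elim d (one_cpl X i) (one_cpl Y j) φ h a' ha' h1 h2 ?_ IH
  show (∑ᶠ _ : Unit, d (X.S i)) = ∑ᶠ _ : Unit, d (Y.S j)
  rw [hst]

theorem good_ex (d : V → G) (hd : ∀ v, d v = d (c v false) + d (c v true)) (n : ℕ) :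
    ∀ (X Y : Fm k c), Nat.card Y.ι = n → ∀ (φ : Sp k X.ι →ₗ[k] Sp k Y.ι) (h : Ex c X.S Y.S φ),
      Good d (qm φ h.isG) := by
  induction n using Nat.strong_induction_on with
  | _ n IH =>
  intro X Y hn φ h
  by_cases h0 : ∃ x, φ x ≠ 0
  swap
  · push Not at h0
    have : qm φ h.isG = 0 := by
      rw [← qm_zero IsG.zero]
      exact qm_eq' (fun x => by simp [h0])
    rw [this]
    exact good_zero d X Y
  obtain ⟨x, hx⟩ := h0
  obtain ⟨m, hm⟩ := exists_Wm x
  induction m generalizing X with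
  | zero => rw [Wm_zero] at hm; simp [hm] at hx
  | succ m ih =>
  by_cases hA : ∀ y ∈ Wm k X.ι 1, φ y = 0
  · obtain ⟨h1, h2⟩ := h.factor hA
    have h3 := ih (sgF X) (φ ∘ₗ tauM) h1 (piM x) (by
      have := DFunLike.congr_fun h2 x
      exact fun h6 => hx (this.symm.trans h6)) (piM_Wm hm)
    have h4 := h3.pre (piI X) (Dg_sg d hd X).symm
    have h5 : qm φ h.isG = (piI X).hom ≫ qm (X := sgF X) (φ ∘ₗ tauM) (Ex.isG (X := sgF X) h1) :=
      qm_eq' (fun x => (DFunLike.congr_fun h2 x).symm)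
    rw [h5]
    exact h4
  · push Not at hA
    obtain ⟨y, hy, hyne⟩ := hA
    obtain ⟨i, j, hij⟩ := exists_i0 h hy hyne
    have hlt : Nat.card (oth Y j).ι < n := by
      rw [← hn]
      exact Finite.card_subtype_lt (p := fun l => l ≠ j) (x := j) (by simp)
    exact good_block d φ h i j hij (fun φ' h' => IH _ hlt (oth X i) (oth Y j) rfl φ' h')

theorem good_all (d : V → G) (hd : ∀ v, d v = d (c v false) + d (c v true)) {X Y : Fm k c}
    (f : X ⟶ Y) : Good d f := by
  obtain ⟨φ, ⟨m, hm⟩, rfl⟩ := qm_surj f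
  induction m generalizing Y with
  | zero => exact good_ex d hd _ X Y rfl φ (Df_zero.1 hm)
  | succ m ih =>
    exact (ih (Y := sgF Y) (piM ∘ₗ φ) hm.pi).of_post (piI Y) (Dg_sg d hd Y).symm

end good

section mon
variable {k : Type u} [Field k] {V : Type} {c : V → Bool → V}

def emF (k : Type u) [Field k] (c : V → Bool → V) : Fm k c := ⟨Empty, inferInstance, Empty.elim⟩
def un (k : Type u) [Field k] (c : V → Bool → V) (v : V) : Fm k c :=
  ⟨Unit, inferInstance, fun _ => v⟩

def Mn (k : Type u) [Field k] (c : V → Bool → V) := Quotient (isIsomorphicSetoid (Fm k c))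

noncomputable def cl (X : Fm k c) : Mn k c := Quotient.mk (isIsomorphicSetoid (Fm k c)) X

theorem cl_eq {X Y : Fm k c} (e : X ≅ Y) : cl X = cl Y :=
  Quotient.sound (s := isIsomorphicSetoid (Fm k c)) ⟨e⟩

theorem cl_iso {X Y : Fm k c} (h : cl X = cl Y) : Nonempty (X ≅ Y) :=
  Quotient.exact (s := isIsomorphicSetoid (Fm k c)) h

noncomputable def sumI {X X' Y Y' : Fm k c} (a : X ≅ X') (b : Y ≅ Y') : sumF X Y ≅ sumF X' Y' :=
  (sum_cpl X Y).iso ≪≫ biprod.mapIso a b ≪≫ (sum_cpl X' Y').iso.symm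

noncomputable def addM (a b : Mn k c) : Mn k c :=
  Quotient.map₂ (sa := isIsomorphicSetoid (Fm k c)) (sb := isIsomorphicSetoid (Fm k c))
    (sc := isIsomorphicSetoid (Fm k c)) sumF
    (fun _ _ h _ _ h' => ⟨sumI h.some h'.some⟩) a b

theorem ind {p : Mn k c → Prop} (h : ∀ X, p (cl X)) (a : Mn k c) : p a :=
  Quotient.ind (s := isIsomorphicSetoid (Fm k c)) h a

theorem addM_cl (X Y : Fm k c) : addM (cl X) (cl Y) = cl (sumF X Y) := rfl

theorem addM_comm (a b : Mn k c) : addM a b = addM b a := by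
  induction a using ind with | _ X
  induction b using ind with | _ Y
  refine cl_eq (reix (X := sumF X Y) (Y := sumF Y X) (Equiv.sumComm X.ι Y.ι)
    (Equiv.bijective _) ?_)
  rintro (i | i) <;> rfl

theorem addM_assoc (a b d : Mn k c) : addM (addM a b) d = addM a (addM b d) := by
  induction a using ind with | _ X
  induction b using ind with | _ Y
  induction d using ind with | _ Z
  refine cl_eq (reix (X := sumF (sumF X Y) Z) (Y := sumF X (sumF Y Z))
    (Equiv.sumAssoc X.ι Y.ι Z.ι) (Equiv.bijective _) ?_)
  rintro ((i | i) | i) <;> rfl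

theorem addM_zero (a : Mn k c) : addM a (cl (emF k c)) = a := by
  induction a using ind with | _ X
  refine (cl_eq (reix (X := X) (Y := sumF X (emF k c)) (Equiv.sumEmpty X.ι Empty).symm
    (Equiv.bijective _) ?_)).symm
  intro i; rfl

noncomputable instance : Add (Mn k c) := ⟨addM⟩
noncomputable instance : Zero (Mn k c) := ⟨cl (emF k c)⟩

noncomputable instance : AddCommMonoid (Mn k c) where
  add_assoc := addM_assoc
  add_comm := addM_comm
  zero_add a := (addM_comm _ _).trans (addM_zero a)
  add_zero := addM_zero
  nsmul := nsmulRec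

theorem cl_cpl {X Y Z : Fm k c} {e : X.ι → Z.ι} {e' : Y.ι → Z.ι} (h : Cpl e e') :
    cl Z = cl X + cl Y :=
  cl_eq (h.iso ≪≫ (sum_cpl X Y).iso.symm)

theorem cl_sum (n : ℕ) : ∀ (X : Fm k c) [Fintype X.ι], Fintype.card X.ι = n →
    cl X = ∑ i, cl (un k c (X.S i)) := by
  classical
  induction n with
  | zero =>
    intro X _ h
    have := Fintype.card_eq_zero_iff.1 h
    rw [Finset.univ_eq_empty, Finset.sum_empty]
    exact (cl_eq (reix (X := emF k c) (Y := X) (fun i => i.elim)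
      ⟨fun i => i.elim, fun j => (this.false j).elim⟩ (fun i => i.elim))).symm
  | succ n ih =>
    intro X _ h
    obtain ⟨i⟩ : Nonempty X.ι := Fintype.card_pos_iff.1 (by rw [h]; exact Nat.succ_pos n)
    rw [cl_cpl (one_cpl X i), Fintype.sum_eq_add_sum_subtype_ne _ i]
    congr 1
    refine @ih (oth X i) (inferInstance : Fintype {j // j ≠ i}) ?_
    have : Fintype.card {j // j ≠ i} = n := by
      rw [Fintype.card_subtype_compl, h]; simp
    exact this

theorem cl_un (v : V) : cl (un k c v) = cl (un k c (c v false)) + cl (un k c (c v true)) := by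
  rw [cl_eq (piI (un k c v))]
  refine (cl_eq (reix (X := sumF (un k c (c v false)) (un k c (c v true))) (Y := sgF (un k c v))
    (Sum.elim (fun _ => ((), false)) (fun _ => ((), true))) ⟨?_, ?_⟩ ?_)).symm
  · rintro (⟨⟩ | ⟨⟩) (⟨⟩ | ⟨⟩) h
    · rfl
    · exact absurd (congrArg Prod.snd h) Bool.false_ne_true
    · exact absurd (congrArg Prod.snd h).symm Bool.false_ne_true
    · rfl
  · rintro ⟨⟨⟩, _ | _⟩
    · exact ⟨Sum.inl (), rfl⟩
    · exact ⟨Sum.inr (), rfl⟩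
  · rintro (i | i) <;> rfl

end mon

end Conc


/-- (Realization theorem.) For every countable abelian group `G`,
element `u ∈ G`, and field `k`, there is a von Neumann regular purely infinite simple
`k`-algebra `R` together with a family `(P_g)` of nonzero finitely generated projective
right `R`-modules indexed by `G` such that `P_{g+h} ≅ P_g ⊕ P_h`, `P_u ≅ R`, and every
nonzero finitely generated projective right `R`-module is isomorphic to `P_g` for
exactly one `g`; i.e. `K₀(R) ≅ G` with `[R] ↦ u`. -/
theorem stmt19 (G : Type) [AddCommGroup G] [Countable G] (u : G) (k : Type u) [Field k] :
    ∃ (R : Type u) (_ : Ring R) (_ : Algebra k R) (P : G → Type u)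
      (_ : ∀ g, AddCommGroup (P g)) (_ : ∀ g, Module Rᵐᵒᵖ (P g)),
      (∀ a : R, ∃ b : R, a * b * a = a) ∧
      PurelyInfiniteSimple R ∧
      (∀ g : G, Nontrivial (P g) ∧ Module.Finite Rᵐᵒᵖ (P g) ∧ Module.Projective Rᵐᵒᵖ (P g)) ∧
      (∀ g h : G, Nonempty (P (g + h) ≃ₗ[Rᵐᵒᵖ] (P g × P h))) ∧
      Nonempty (P u ≃ₗ[Rᵐᵒᵖ] R) ∧
      (∀ (Q : Type u) [AddCommGroup Q] [Module Rᵐᵒᵖ Q],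
        Nontrivial Q → Module.Finite Rᵐᵒᵖ Q → Module.Projective Rᵐᵒᵖ Q →
          ∃! g : G, Nonempty (Q ≃ₗ[Rᵐᵒᵖ] P g)) := by
  classical
  obtain ⟨δ, T, hδ, hTz, hT0, hTc, hTs⟩ := exists_T (G := G)
  have hd := dgr_cgr δ T hTz
  have h3 : ∀ X Y : Fm k (cgr T), (X ≅ Y) → Dg (dgr δ) X = Dg (dgr δ) Y :=
    fun X Y e => (good_all (dgr δ) hd e.hom).2 inferInstance
  refine abstract_realization (C := Fm k (cgr T)) k G u (Dg (dgr δ)) ?_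
    (fun f => (good_all (dgr δ) hd f).1) ?_ h3 ?_ ?_
  · exact ⟨emF k _, id_eq_zero.2 (inferInstanceAs (IsEmpty Empty))⟩
  · intro X Y hX hY h
    let _ := Fintype.ofFinite X.ι
    let _ := Fintype.ofFinite Y.ι
    have key : ∀ X : Fm k (cgr T), CategoryTheory.CategoryStruct.id X ≠ 0 → ∀ [Fintype X.ι],
        (Finset.univ.val.map X.S) ≠ 0 := by
      intro X hX _ h
      apply hX
      rw [id_eq_zero]
      rw [Multiset.map_eq_zero, Finset.val_eq_zero, Finset.univ_eq_empty_iff] at h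
      exact h
    have hDg : ∀ X : Fm k (cgr T), ∀ [Fintype X.ι],
        ((Finset.univ.val.map X.S).map (dgr δ)).sum = Dg (dgr δ) X := by
      intro X _
      rw [Dg, finsum_eq_sum_of_fintype, Multiset.map_map]; rfl
    have := comb δ T hδ hTz hT0 hTc hTs (fun v => cl (un k (cgr T) v)) cl_un
      (Finset.univ.val.map X.S) (Finset.univ.val.map Y.S) (key X hX) (key Y hY)
      (by rw [hDg, hDg, h])
    rw [Multiset.map_map, Multiset.map_map] at this
    apply cl_iso
    rw [cl_sum _ X rfl, cl_sum _ Y rfl]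
    exact this
  · intro X Y
    rw [← h3 _ _ (sum_cpl X Y).iso, Dg_sum]
  · intro g
    obtain ⟨n, rfl⟩ := hδ g
    refine ⟨un k _ (Sum.inl n), fun h => (id_eq_zero.1 h).false (), ?_⟩
    exact finsum_unique (fun _ : Unit => δ n)
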